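/- Let d = 4. For every σ ∈ (1, 3/2) there exists a constant C = C(σ) such that for all λ ∈ ℂ and all ψ ∈ ℓ^{2σ/(σ+1)}(ℤ⁴), ‖ψ‖_{ℓ^{2σ/(σ−1)}(ℤ⁴)} ≤ C ‖(√(1−Δ) − λ)ψ‖_{ℓ^{2σ/(σ+1)}(ℤ⁴)}. -/

import Mathlib

open MeasureTheory Real
open scoped ENNReal

noncomputable section

/-- Dispersion relation of the discrete Klein--Gordon equation on `ℤ^d`. -/
def omegaKG (d : ℕ) (ξ : Fin d → ℝ) : ℝ :=
  Real.sqrt (1 + ∑ j : Fin d, 2 * (1 - Real.cos (ξ j)))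

/-- The fundamental domain `[0, 2π]^d` of the torus. -/
def cube (d : ℕ) : Set (Fin d → ℝ) := Set.Icc 0 (fun _ => 2 * Real.pi)

/-- The convolution kernel of the Fourier multiplier on `ℤ^d` with symbol `m(ξ)`. -/
def multKernel (d : ℕ) (m : (Fin d → ℝ) → ℝ) (x : Fin d → ℤ) : ℂ :=
  ((((2 * Real.pi) ^ d)⁻¹ : ℝ) : ℂ) *
    ∫ ξ in cube d,
      Complex.exp (Complex.I * ((∑ j : Fin d, (x j : ℝ) * ξ j : ℝ) : ℂ)) * ((m ξ : ℝ) : ℂ)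

/-- The propagator `cos(t√(1−Δ))`, realized as the Fourier multiplier with symbol
`cos(t ω(ξ))`. -/
def cosProp (d : ℕ) (t : ℝ) (f : (Fin d → ℤ) → ℂ) (x : Fin d → ℤ) : ℂ :=
  ∑' y : Fin d → ℤ, multKernel d (fun ξ => Real.cos (t * omegaKG d ξ)) (x - y) * f y

/-- The propagator `sin(t√(1−Δ))/√(1−Δ)`, realized as the Fourier multiplier with symbol
`sin(t ω(ξ))/ω(ξ)`. -/
def sinProp (d : ℕ) (t : ℝ) (f : (Fin d → ℤ) → ℂ) (x : Fin d → ℤ) : ℂ :=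
  ∑' y : Fin d → ℤ, multKernel d (fun ξ => Real.sin (t * omegaKG d ξ) / omegaKG d ξ) (x - y) * f y

/-- The operator `√(1−Δ)`, realized as the Fourier multiplier with symbol `ω(ξ)`. -/
def sqrtOneSubLap (d : ℕ) (f : (Fin d → ℤ) → ℂ) (x : Fin d → ℤ) : ℂ :=
  ∑' y : Fin d → ℤ, multKernel d (omegaKG d) (x - y) * f y

/-- The solution of the inhomogeneous discrete Klein--Gordon equation with data `(f,g)`
and forcing term `F`, given by Duhamel's formula. -/
def duhamel (d : ℕ) (t : ℝ) (f g : (Fin d → ℤ) → ℂ) (F : ℝ → (Fin d → ℤ) → ℂ)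
    (x : Fin d → ℤ) : ℂ :=
  cosProp d t f x + sinProp d t g x + ∫ s in (0:ℝ)..t, sinProp d (t - s) (F s) x

/-- The `L^q` norm in time of an `ℝ≥0∞`-valued function. -/
def lqNorm (q : ℝ≥0∞) (g : ℝ → ℝ≥0∞) : ℝ≥0∞ :=
  if q = ∞ then essSup g volume else (∫⁻ t, g t ^ q.toReal) ^ (1 / q.toReal)

/-- The mixed space-time norm `‖F‖_{L^q_t ℓ^r_x}`. -/
def mixedNorm (d : ℕ) (q r : ℝ≥0∞) (F : ℝ → (Fin d → ℤ) → ℂ) : ℝ≥0∞ :=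
  lqNorm q fun t => eLpNorm (F t) r Measure.count

/-- First derivative test: an oscillatory integral with monotone phase derivative bounded away
from zero. -/
theorem norm_integral_exp_le_of_le_abs_deriv {φ φ' φ'' : ℝ → ℝ} {a b μ : ℝ} (hab : a ≤ b)
    (hμ : 0 < μ) (hφ : ∀ t, HasDerivAt φ (φ' t) t) (hφ' : ∀ t, HasDerivAt φ' (φ'' t) t)
    (hc : Continuous φ'') (hpos : ∀ t ∈ Set.Icc a b, 0 ≤ φ'' t)
    (hlow : ∀ t ∈ Set.Icc a b, μ ≤ |φ' t|) :
    ‖∫ t in a..b, Complex.exp (Complex.I * φ t)‖ ≤ 4 / μ := by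
  have hne : ∀ t ∈ Set.Icc a b, φ' t ≠ 0 := fun t ht h0 => by
    have := hlow t ht
    rw [h0, abs_zero] at this
    linarith
  have hcφ : Continuous φ := continuous_iff_continuousAt.2 fun t => (hφ t).continuousAt
  have hcφ' : Continuous φ' := continuous_iff_continuousAt.2 fun t => (hφ' t).continuousAt
  have huIcc : Set.uIcc a b = Set.Icc a b := Set.uIcc_of_le hab
  set e : ℝ → ℂ := fun t => Complex.exp (Complex.I * φ t) with he
  have hce : Continuous e := by fun_prop
  have hnorm : ∀ t, ‖e t‖ = 1 := fun t => by
    simp only [he]; rw [mul_comm]; exact Complex.norm_exp_ofReal_mul_I _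
  have hde : ∀ t, HasDerivAt e (e t * (Complex.I * φ' t)) t := fun t =>
    ((hφ t).ofReal_comp.const_mul Complex.I).cexp
  set F : ℝ → ℂ := fun t => e t * (Complex.I * φ' t)⁻¹ with hF
  set R : ℝ → ℂ := fun t => e t * (Complex.I * φ'' t / (Complex.I * φ' t) ^ 2) with hR
  have hdF : ∀ t ∈ Set.uIcc a b, HasDerivAt F (e t - R t) t := fun t ht => by
    have h1 : (φ' t : ℂ) ≠ 0 := by exact_mod_cast hne t (huIcc ▸ ht)
    have h0 : (Complex.I * (φ' t : ℂ)) ≠ 0 := mul_ne_zero Complex.I_ne_zero h1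
    have := (hde t).mul (((hφ' t).ofReal_comp.const_mul Complex.I).inv h0)
    refine this.congr_deriv ?_
    simp only [hR, Pi.inv_apply]
    rw [mul_inv_cancel_right₀ h0]
    ring
  have hRc : ContinuousOn R (Set.uIcc a b) := by
    refine hce.continuousOn.mul (ContinuousOn.div (by fun_prop) (by fun_prop) fun t ht => ?_)
    exact pow_ne_zero _ (mul_ne_zero Complex.I_ne_zero (by exact_mod_cast hne t (huIcc ▸ ht)))
  have hRi : IntervalIntegrable R volume a b := hRc.intervalIntegrable
  have hei : IntervalIntegrable e volume a b := hce.intervalIntegrable _ _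
  have h1 : ∫ t in a..b, (e t - R t) = F b - F a :=
    intervalIntegral.integral_eq_sub_of_hasDerivAt hdF (hei.sub hRi)
  have h2 : ∫ t in a..b, e t = F b - F a + ∫ t in a..b, R t := by
    rw [← h1, intervalIntegral.integral_sub hei hRi]; ring
  have hquot : ContinuousOn (fun t => φ'' t / φ' t ^ 2) (Set.uIcc a b) :=
    hc.continuousOn.div (by fun_prop) fun t ht => pow_ne_zero _ (hne t (huIcc ▸ ht))
  have h3 : ∫ t in a..b, φ'' t / φ' t ^ 2 = -(φ' b)⁻¹ - -(φ' a)⁻¹ := by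
    refine intervalIntegral.integral_eq_sub_of_hasDerivAt (f := fun t => -(φ' t)⁻¹)
      (fun t ht => ?_) hquot.intervalIntegrable
    refine ((hφ' t).inv (hne t (huIcc ▸ ht))).neg.congr_deriv ?_
    ring
  have h4 : ‖∫ t in a..b, R t‖ ≤ ∫ t in a..b, φ'' t / φ' t ^ 2 := by
    refine intervalIntegral.norm_integral_le_of_norm_le hab (ae_of_all _ fun t ht => ?_)
      hquot.intervalIntegrable
    simp only [hR, norm_mul, hnorm, norm_div, norm_pow, Complex.norm_I, one_mul,
      Complex.norm_real, Real.norm_eq_abs, sq_abs]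
    rw [abs_of_nonneg (hpos t ⟨ht.1.le, ht.2⟩)]
  have hinv : ∀ t ∈ Set.Icc a b, |(φ' t)⁻¹| ≤ μ⁻¹ := fun t ht => by
    rw [abs_inv]; exact inv_anti₀ hμ (hlow t ht)
  have hFn : ∀ t ∈ Set.Icc a b, ‖F t‖ ≤ μ⁻¹ := fun t ht => by
    simp only [hF, norm_mul, hnorm, norm_inv, Complex.norm_I, one_mul, Complex.norm_real,
      Real.norm_eq_abs]
    rw [← abs_inv]; exact hinv t ht
  have ha : a ∈ Set.Icc a b := ⟨le_rfl, hab⟩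
  have hb : b ∈ Set.Icc a b := ⟨hab, le_rfl⟩
  rw [h2]
  calc ‖F b - F a + ∫ t in a..b, R t‖ ≤ ‖F b‖ + ‖F a‖ + ‖∫ t in a..b, R t‖ :=
        (norm_add_le _ _).trans (add_le_add_left (norm_sub_le _ _) _)
    _ ≤ μ⁻¹ + μ⁻¹ + (μ⁻¹ + μ⁻¹) := by
        refine add_le_add (add_le_add (hFn b hb) (hFn a ha)) ?_
        rw [h3] at h4
        have := (abs_le.1 (hinv a ha)).2
        have := (abs_le.1 (hinv b hb)).1
        linarith
    _ = 4 / μ := by ring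

/-- Second derivative test (van der Corput). -/
theorem norm_integral_exp_le_of_le_deriv2 {φ φ' φ'' : ℝ → ℝ} {a b lam : ℝ} (hab : a ≤ b)
    (hlam : 0 < lam) (hφ : ∀ t, HasDerivAt φ (φ' t) t) (hφ' : ∀ t, HasDerivAt φ' (φ'' t) t)
    (hc : Continuous φ'') (hlow : ∀ t ∈ Set.Icc a b, lam ≤ φ'' t) :
    ‖∫ t in a..b, Complex.exp (Complex.I * φ t)‖ ≤ 8 / √lam := by
  have hcφ : Continuous φ := continuous_iff_continuousAt.2 fun t => (hφ t).continuousAt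
  have hcφ' : Continuous φ' := continuous_iff_continuousAt.2 fun t => (hφ' t).continuousAt
  have hgrow : ∀ s ∈ Set.Icc a b, ∀ t ∈ Set.Icc a b, s ≤ t → lam * (t - s) ≤ φ' t - φ' s :=
    fun s hs t ht hst => by
      refine (convex_Icc a b).mul_sub_le_image_sub_of_le_deriv hcφ'.continuousOn
        (fun u _ => (hφ' u).differentiableAt.differentiableWithinAt) (fun u hu => ?_) s hs t ht hst
      rw [(hφ' u).deriv]
      exact hlow u (interior_subset hu)
  have ha : a ∈ Set.Icc a b := ⟨le_rfl, hab⟩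
  have hb : b ∈ Set.Icc a b := ⟨hab, le_rfl⟩
  obtain ⟨c, hcm, hcl⟩ : ∃ c ∈ Set.Icc a b, ∀ t ∈ Set.Icc a b, lam * |t - c| ≤ |φ' t| := by
    rcases le_total 0 (φ' a) with h0 | h0
    · refine ⟨a, ha, fun t ht => ?_⟩
      rw [abs_of_nonneg (sub_nonneg.2 ht.1)]
      have := hgrow a ha t ht ht.1
      exact le_trans (by linarith) (le_abs_self _)
    rcases le_total (φ' b) 0 with h1 | h1
    · refine ⟨b, hb, fun t ht => ?_⟩
      rw [abs_of_nonpos (sub_nonpos.2 ht.2)]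
      have := hgrow t ht b hb ht.2
      exact le_trans (by linarith) (neg_le_abs _)
    obtain ⟨c, hcm, hc0⟩ := intermediate_value_Icc hab hcφ'.continuousOn ⟨h0, h1⟩
    refine ⟨c, hcm, fun t ht => ?_⟩
    rcases le_total t c with h | h
    · rw [abs_of_nonpos (sub_nonpos.2 h)]
      have := hgrow t ht c hcm h
      exact le_trans (by linarith) (neg_le_abs _)
    · rw [abs_of_nonneg (sub_nonneg.2 h)]
      have := hgrow c hcm t ht h
      exact le_trans (by linarith) (le_abs_self _)
  have hs : 0 < √lam := Real.sqrt_pos.2 hlam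
  have hss : √lam * √lam = lam := Real.mul_self_sqrt hlam.le
  set δ : ℝ := 2 / √lam with hδ
  have hδ0 : 0 < δ := by positivity
  have hprod : lam * δ = 2 * √lam := by
    calc lam * δ = √lam * √lam * (2 / √lam) := by rw [hss]
      _ = 2 * √lam := by field_simp
  set l := max a (c - δ)
  set r := min b (c + δ)
  have hal : a ≤ l := le_max_left _ _
  have hlc : l ≤ c := max_le hcm.1 (by linarith)
  have hcr : c ≤ r := le_min hcm.2 (by linarith)
  have hrb : r ≤ b := min_le_left _ _
  set e : ℝ → ℂ := fun t => Complex.exp (Complex.I * φ t) with he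
  have hce : Continuous e := by fun_prop
  have hi : ∀ u v, IntervalIntegrable e volume u v := fun u v => hce.intervalIntegrable _ _
  have h1 : ‖∫ t in a..l, e t‖ ≤ 4 / (lam * δ) := by
    rcases le_or_gt a (c - δ) with h | h
    · refine norm_integral_exp_le_of_le_abs_deriv hal (by positivity) hφ hφ' hc
        (fun t ht => hlam.le.trans (hlow t ⟨ht.1, ht.2.trans (hlc.trans hcm.2)⟩)) fun t ht => ?_
      refine le_trans ?_ (hcl t ⟨ht.1, ht.2.trans (hlc.trans hcm.2)⟩)
      have : t ≤ c - δ := ht.2.trans (max_le h le_rfl)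
      rw [abs_of_nonpos (by linarith)]
      gcongr
      linarith
    · have : l = a := max_eq_left h.le
      rw [this, intervalIntegral.integral_same, norm_zero]
      positivity
  have h3 : ‖∫ t in r..b, e t‖ ≤ 4 / (lam * δ) := by
    rcases le_or_gt (c + δ) b with h | h
    · refine norm_integral_exp_le_of_le_abs_deriv hrb (by positivity) hφ hφ' hc
        (fun t ht => hlam.le.trans (hlow t ⟨hcm.1.trans (hcr.trans ht.1), ht.2⟩)) fun t ht => ?_
      refine le_trans ?_ (hcl t ⟨hcm.1.trans (hcr.trans ht.1), ht.2⟩)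
      have : c + δ ≤ t := (le_min h le_rfl).trans ht.1
      rw [abs_of_nonneg (by linarith)]
      gcongr
      linarith
    · have : r = b := min_eq_left h.le
      rw [this, intervalIntegral.integral_same, norm_zero]
      positivity
  have h2 : ‖∫ t in l..r, e t‖ ≤ 2 * δ := by
    refine (intervalIntegral.norm_integral_le_of_norm_le_const (C := 1) fun t _ => ?_).trans ?_
    · simp only [he]; rw [mul_comm]; exact (Complex.norm_exp_ofReal_mul_I _).le
    · rw [abs_of_nonneg (by linarith), one_mul]
      have : c - δ ≤ l := le_max_right _ _
      have : r ≤ c + δ := min_le_right _ _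
      linarith
  rw [← intervalIntegral.integral_add_adjacent_intervals (hi a l) (hi l b),
    ← intervalIntegral.integral_add_adjacent_intervals (hi l r) (hi r b)]
  refine (norm_add_le _ _).trans ((add_le_add h1 ((norm_add_le _ _).trans
    (add_le_add h2 h3))).trans (le_of_eq ?_))
  rw [hprod, hδ]
  field_simp
  norm_num

/-- The integral of `e^{i(nθ - x sin θ)}` over the quarter period `[0, π/2]`. -/
def besselQuarter (n x : ℝ) : ℂ :=
  ∫ θ in (0:ℝ)..π / 2, Complex.exp (Complex.I * ((n * θ - x * Real.sin θ : ℝ) : ℂ))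

/-- The propagator kernel `(2π)⁻¹ ∫ e^{i(nξ + 2s cos ξ)} dξ` of the one-dimensional lattice, a
Bessel function up to a phase. -/
def latticeBessel (s : ℝ) (n : ℤ) : ℂ :=
  (((2 * π)⁻¹ : ℝ) : ℂ) *
    ∫ ξ in (0:ℝ)..2 * π, Complex.exp (Complex.I * ((n * ξ + 2 * s * Real.cos ξ : ℝ) : ℂ))

section besselQuarter

variable (n x : ℝ)

theorem hasDerivAt_besselPhase (t : ℝ) :
    HasDerivAt (fun θ => n * θ - x * Real.sin θ) (n - x * Real.cos t) t :=
  (((hasDerivAt_id t).const_mul n).sub ((Real.hasDerivAt_sin t).const_mul x)).congr_deriv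
    (by rw [mul_one])

theorem hasDerivAt_besselPhase_deriv (t : ℝ) :
    HasDerivAt (fun θ => n - x * Real.cos θ) (x * Real.sin t) t := by
  simpa using ((Real.hasDerivAt_cos t).const_mul x).const_sub n

theorem norm_integral_besselPhase_le (a b : ℝ) (hab : a ≤ b) :
    ‖∫ θ in a..b, Complex.exp (Complex.I * ((n * θ - x * Real.sin θ : ℝ) : ℂ))‖ ≤ b - a := by
  refine (intervalIntegral.norm_integral_le_of_norm_le_const (C := 1) fun t _ => ?_).trans ?_
  · rw [mul_comm]; exact (Complex.norm_exp_ofReal_mul_I _).le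
  · rw [abs_of_nonneg (by linarith), one_mul]

theorem besselQuarter_split (c : ℝ) : besselQuarter n x =
    (∫ θ in (0:ℝ)..c, Complex.exp (Complex.I * ((n * θ - x * Real.sin θ : ℝ) : ℂ))) +
    ∫ θ in c..π / 2, Complex.exp (Complex.I * ((n * θ - x * Real.sin θ : ℝ) : ℂ)) :=
  (intervalIntegral.integral_add_adjacent_intervals
    ((by fun_prop : Continuous _).intervalIntegrable _ _)
    ((by fun_prop : Continuous _).intervalIntegrable _ _)).symm

variable {n x}

theorem norm_besselQuarter_le_inv {r : ℝ} (hr : 1 ≤ r) (hx : r ^ 3 ≤ x) :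
    ‖besselQuarter n x‖ ≤ 17 / r := by
  have hπ := Real.pi_gt_three
  have hr0 : 0 < r := by linarith
  have hx0 : 0 < x := lt_of_lt_of_le (by positivity) hx
  have hδ1 : 1 / r ≤ 1 := by rw [div_le_one hr0]; exact hr
  have hδ0 : 0 < 1 / r := by positivity
  rw [besselQuarter_split n x (1 / r)]
  have hlow : ∀ t ∈ Set.Icc (1 / r) (π / 2), (r / 2) ^ 2 ≤ x * Real.sin t := fun t ht => by
    have h1 : 2 / π * t ≤ Real.sin t := Real.mul_le_sin (hδ0.le.trans ht.1) ht.2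
    have h2 : (1 / 2) * (1 / r) ≤ Real.sin t := by
      refine le_trans ?_ h1
      refine mul_le_mul ?_ ht.1 hδ0.le (by positivity)
      rw [div_le_div_iff₀ (by norm_num) Real.pi_pos]
      linarith [Real.pi_le_four]
    calc (r / 2) ^ 2 ≤ r ^ 3 * ((1 / 2) * (1 / r)) := by
          field_simp
          norm_num
      _ ≤ x * Real.sin t := by gcongr
  have h2 := norm_integral_exp_le_of_le_deriv2 (a := 1 / r) (b := π / 2) (by linarith)
    (by positivity : (0:ℝ) < (r / 2) ^ 2) (hasDerivAt_besselPhase n x)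
    (hasDerivAt_besselPhase_deriv n x) (by fun_prop) hlow
  rw [Real.sqrt_sq (by positivity)] at h2
  have h1 := norm_integral_besselPhase_le n x 0 (1 / r) hδ0.le
  refine (norm_add_le _ _).trans ((add_le_add h1 h2).trans (le_of_eq ?_))
  field_simp
  norm_num

theorem norm_besselQuarter_le_of_le_abs_deriv {D : ℝ} (hD : 0 < D) (hx : 0 < x)
    (h : ∀ t ∈ Set.Icc 0 (π / 2), D ≤ |n - x * Real.cos t|) :
    ‖besselQuarter n x‖ ≤ 4 / D := by
  have hπ := Real.pi_gt_three
  refine norm_integral_exp_le_of_le_abs_deriv (by positivity) hD (hasDerivAt_besselPhase n x)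
    (hasDerivAt_besselPhase_deriv n x) (by fun_prop) (fun t ht => ?_) h
  exact mul_nonneg hx.le (Real.sin_nonneg_of_nonneg_of_le_pi ht.1 (by linarith [ht.2]))

theorem norm_besselQuarter_le_div_sqrt {E : ℝ} (hE : 1 ≤ E) (hx : 0 < x)
    (hD : 2 * E ^ 2 ≤ |x - (|n|)|) : ‖besselQuarter n x‖ ≤ 12 / E := by
  have hπ := Real.pi_gt_three
  have hE0 : 0 < E := by linarith
  have hEE : E ≤ E ^ 2 := by nlinarith
  have hcos0 : ∀ t ∈ Set.Icc 0 (π / 2), 0 ≤ Real.cos t := fun t ht =>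
    Real.cos_nonneg_of_neg_pi_div_two_le_of_le (by linarith [ht.1]) ht.2
  have hfour : 4 / E ≤ 12 / E := by gcongr; norm_num
  rcases le_or_gt x |n| with hxn | hxn
  · rw [abs_of_nonpos (by linarith)] at hD
    refine (norm_besselQuarter_le_of_le_abs_deriv (D := E) hE0 hx fun t ht => ?_).trans hfour
    have hc0 := hcos0 t ht
    have hc1 : x * Real.cos t ≤ x := mul_le_of_le_one_right hx.le (Real.cos_le_one t)
    have hc2 : 0 ≤ x * Real.cos t := by positivity
    rcases le_total 0 n with h | h
    · rw [abs_of_nonneg h] at hD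
      exact le_trans (by linarith) (le_abs_self _)
    · rw [abs_of_nonpos h] at hD
      exact le_trans (by linarith) (neg_le_abs _)
  · rw [abs_of_pos (by linarith)] at hD
    have hn : n ≤ |n| := le_abs_self n
    have hn0 : 0 ≤ |n| := abs_nonneg n
    have hq0 : 0 < E ^ 2 / x := by positivity
    have hq1 : E ^ 2 / x ≤ 1 / 2 := by
      rw [div_le_div_iff₀ hx (by norm_num)]; linarith
    set θ₀ := Real.arccos (1 - E ^ 2 / x) with hθ
    have hcθ : Real.cos θ₀ = 1 - E ^ 2 / x := Real.cos_arccos (by linarith) (by linarith)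
    have hθ0 : 0 ≤ θ₀ := Real.arccos_nonneg _
    have hθ1 : θ₀ ≤ π / 2 := Real.arccos_le_pi_div_two.2 (by linarith)
    have hxc : x * Real.cos θ₀ = x - E ^ 2 := by rw [hcθ]; field_simp
    have h1 := norm_integral_exp_le_of_le_abs_deriv hθ0 hE0 (hasDerivAt_besselPhase n x)
      (hasDerivAt_besselPhase_deriv n x) (by fun_prop)
      (fun t ht => mul_nonneg hx.le
        (Real.sin_nonneg_of_nonneg_of_le_pi ht.1 (by linarith [ht.2]))) (fun t ht => by
        have : Real.cos θ₀ ≤ Real.cos t :=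
          Real.cos_le_cos_of_nonneg_of_le_pi ht.1 (by linarith) ht.2
        have : x * Real.cos θ₀ ≤ x * Real.cos t := by gcongr
        exact le_trans (by linarith) (neg_le_abs _))
    have h2 := norm_integral_exp_le_of_le_deriv2 hθ1 (by positivity : (0:ℝ) < E ^ 2)
      (hasDerivAt_besselPhase n x)
      (hasDerivAt_besselPhase_deriv n x) (by fun_prop) (fun t ht => by
        have hs : Real.sin θ₀ ≤ Real.sin t :=
          Real.sin_le_sin_of_le_of_le_pi_div_two (by linarith) ht.2 ht.1
        have hs0 : 0 ≤ Real.sin θ₀ := Real.sin_nonneg_of_nonneg_of_le_pi hθ0 (by linarith)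
        refine le_trans ?_ (mul_le_mul_of_nonneg_left hs hx.le)
        refine le_of_sq_le_sq ?_ (by positivity)
        have hsq : Real.sin θ₀ ^ 2 = E ^ 2 / x * (2 - E ^ 2 / x) := by
          rw [Real.sin_sq, hcθ]; ring
        rw [mul_pow, hsq]
        calc (E ^ 2) ^ 2 ≤ x * E ^ 2 := by nlinarith [sq_nonneg E]
          _ = x ^ 2 * (E ^ 2 / x * 1) := by field_simp
          _ ≤ x ^ 2 * (E ^ 2 / x * (2 - E ^ 2 / x)) := by gcongr; linarith)
    rw [Real.sqrt_sq hE0.le] at h2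
    rw [besselQuarter_split n x θ₀]
    refine (norm_add_le _ _).trans ((add_le_add h1 h2).trans (le_of_eq ?_))
    ring

/-- Uniform decay of the quarter-period Bessel integral, capturing the turning point
`|n| = x`. -/
theorem norm_besselQuarter_pow_four_le {r : ℝ} (hr : 1 ≤ r) (hx : 2 * r ^ 3 ≤ x) :
    ‖besselQuarter n x‖ ^ 4 ≤ 10 ^ 6 / (r ^ 4 + (x - |n|) ^ 2) := by
  have hr0 : 0 < r := by linarith
  have hx0 : 0 < x := lt_of_lt_of_le (by positivity) hx
  rw [le_div_iff₀ (by positivity)]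
  rcases le_or_gt |x - (|n|)| (2 * r ^ 2) with h | h
  · have h1 := norm_besselQuarter_le_inv (n := n) (x := x) hr
      (by nlinarith [pow_pos hr0 3])
    have h2 : (x - |n|) ^ 2 ≤ (2 * r ^ 2) ^ 2 := by
      rw [← sq_abs]; gcongr
    calc _ ≤ (17 / r) ^ 4 * (r ^ 4 + (2 * r ^ 2) ^ 2) := by gcongr
      _ = 17 ^ 4 * 5 := by field_simp; ring
      _ ≤ 10 ^ 6 := by norm_num
  · set D := |x - (|n|)| with hD
    have hDpos : 0 < D := lt_trans (by positivity) h
    have hsq : √(D / 2) ^ 2 = D / 2 := Real.sq_sqrt (by positivity)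
    have hE : 1 ≤ √(D / 2) := by
      rw [Real.one_le_sqrt]
      nlinarith
    have h1 := norm_besselQuarter_le_div_sqrt (n := n) (x := x) hE hx0 (by
      rw [hsq, ← hD]; linarith)
    have h2 : (x - |n|) ^ 2 = D ^ 2 := (sq_abs _).symm
    have h3 : r ^ 4 ≤ D ^ 2 := by nlinarith [pow_pos hr0 2]
    rw [h2]
    calc _ ≤ (12 / √(D / 2)) ^ 4 * (D ^ 2 + D ^ 2) := by gcongr
      _ = 12 ^ 4 / (√(D / 2) ^ 2) ^ 2 * (D ^ 2 + D ^ 2) := by rw [div_pow]; ring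
      _ = 12 ^ 4 * 8 := by rw [hsq]; field_simp; ring
      _ ≤ 10 ^ 6 := by norm_num

end besselQuarter

section latticeBessel

theorem continuous_latticeBessel (n : ℤ) : Continuous fun s => latticeBessel s n := by
  refine continuous_const.mul ?_
  refine intervalIntegral.continuous_parametric_intervalIntegral_of_continuous' ?_ _ _
  fun_prop

theorem norm_latticeBessel_le_one (s : ℝ) (n : ℤ) : ‖latticeBessel s n‖ ≤ 1 := by
  have hπ := Real.pi_pos
  have h : ‖∫ ξ in (0:ℝ)..2 * π,
      Complex.exp (Complex.I * ((n * ξ + 2 * s * Real.cos ξ : ℝ) : ℂ))‖ ≤ 2 * π := by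
    refine (intervalIntegral.norm_integral_le_of_norm_le_const (C := 1) fun t _ => ?_).trans ?_
    · rw [mul_comm]; exact (Complex.norm_exp_ofReal_mul_I _).le
    · rw [sub_zero, abs_of_pos (by positivity), one_mul]
  rw [latticeBessel, norm_mul, Complex.norm_real, Real.norm_eq_abs, abs_of_pos (by positivity)]
  calc _ ≤ (2 * π)⁻¹ * (2 * π) := by gcongr
    _ = 1 := inv_mul_cancel₀ (by positivity)

theorem norm_latticeBessel_le_besselQuarter (s : ℝ) (n : ℤ) :
    ‖latticeBessel s n‖ ≤
      (2 * π)⁻¹ * (2 * ‖besselQuarter n (2 * s)‖ + 2 * ‖besselQuarter (-n) (2 * s)‖) := by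
  have hπ := Real.pi_pos
  set f : ℝ → ℂ := fun ξ => Complex.exp (Complex.I * ((n * ξ + 2 * s * Real.cos ξ : ℝ) : ℂ))
    with hf
  have hfc : Continuous f := by fun_prop
  have hi : ∀ u v, IntervalIntegrable f volume u v := fun u v => hfc.intervalIntegrable _ _
  have hsplit : ∫ ξ in (0:ℝ)..2 * π, f ξ = (∫ ξ in (0:ℝ)..π / 2, f ξ) +
      ((∫ ξ in π / 2..π, f ξ) + ((∫ ξ in π..3 * π / 2, f ξ) + ∫ ξ in 3 * π / 2..2 * π, f ξ)) := by
    simp only [intervalIntegral.integral_add_adjacent_intervals, hi]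
  have hconj : ∀ m x : ℝ, ‖∫ θ in (0:ℝ)..π / 2,
      Complex.exp (Complex.I * ((-(m * θ - x * Real.sin θ) : ℝ) : ℂ))‖ = ‖besselQuarter m x‖ := by
    intro m x
    rw [← Complex.norm_conj (besselQuarter m x), besselQuarter,
      intervalIntegral.integral_of_le (by positivity), intervalIntegral.integral_of_le (by positivity),
      ← integral_conj]
    simp only [← Complex.exp_conj, map_mul, Complex.conj_I, Complex.conj_ofReal,
      Complex.ofReal_neg, mul_neg, neg_mul]
  have hmul : ∀ (c : ℝ) (g : ℝ → ℝ), ‖∫ θ in (0:ℝ)..π / 2,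
      Complex.exp (Complex.I * ((c + g θ : ℝ) : ℂ))‖ =
      ‖∫ θ in (0:ℝ)..π / 2, Complex.exp (Complex.I * (g θ : ℂ))‖ := by
    intro c g
    simp only [Complex.ofReal_add, mul_add, Complex.exp_add]
    rw [intervalIntegral.integral_const_mul, norm_mul, mul_comm Complex.I,
      Complex.norm_exp_ofReal_mul_I, one_mul]
  have h1 : ‖∫ ξ in (0:ℝ)..π / 2, f ξ‖ = ‖besselQuarter n (2 * s)‖ := by
    have : ∫ ξ in (0:ℝ)..π / 2, f ξ = ∫ θ in (0:ℝ)..π / 2, f (π / 2 - θ) := by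
      rw [intervalIntegral.integral_comp_sub_left]; simp
    rw [this, ← hconj]
    refine Eq.trans ?_ (hmul (n * (π / 2)) fun θ => -(n * θ - 2 * s * Real.sin θ))
    simp only [hf, Real.cos_pi_div_two_sub]
    congr! 5
    ring_nf
  have h2 : ‖∫ ξ in π / 2..π, f ξ‖ = ‖besselQuarter n (2 * s)‖ := by
    have : ∫ ξ in π / 2..π, f ξ = ∫ θ in (0:ℝ)..π / 2, f (π / 2 + θ) := by
      rw [intervalIntegral.integral_comp_add_left]; simp
    rw [this, besselQuarter]
    refine Eq.trans ?_ (hmul (n * (π / 2)) fun θ => n * θ - 2 * s * Real.sin θ)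
    simp only [hf, add_comm (π / 2), Real.cos_add_pi_div_two]
    congr! 5
    ring_nf
  have h3 : ‖∫ ξ in π..3 * π / 2, f ξ‖ = ‖besselQuarter (-n) (2 * s)‖ := by
    have : ∫ ξ in π..3 * π / 2, f ξ = ∫ θ in (0:ℝ)..π / 2, f (3 * π / 2 - θ) := by
      rw [intervalIntegral.integral_comp_sub_left]
      congr 1 <;> ring
    rw [this, besselQuarter]
    refine Eq.trans ?_ (hmul (n * (3 * π / 2)) fun θ => -n * θ - 2 * s * Real.sin θ)
    have hc : ∀ θ, Real.cos (3 * π / 2 - θ) = - Real.sin θ := fun θ => by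
      rw [show 3 * π / 2 - θ = π / 2 - θ + π by ring, Real.cos_add_pi, Real.cos_pi_div_two_sub]
    simp only [hf, hc]
    congr! 5
    ring_nf
  have h4 : ‖∫ ξ in 3 * π / 2..2 * π, f ξ‖ = ‖besselQuarter (-n) (2 * s)‖ := by
    have : ∫ ξ in 3 * π / 2..2 * π, f ξ = ∫ θ in (0:ℝ)..π / 2, f (3 * π / 2 + θ) := by
      rw [intervalIntegral.integral_comp_add_left]
      congr 1 <;> ring
    rw [this, ← hconj]
    refine Eq.trans ?_ (hmul (n * (3 * π / 2)) fun θ => -(-n * θ - 2 * s * Real.sin θ))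
    have hc : ∀ θ, Real.cos (3 * π / 2 + θ) = Real.sin θ := fun θ => by
      rw [show 3 * π / 2 + θ = θ + π / 2 + π by ring, Real.cos_add_pi, Real.cos_add_pi_div_two,
        neg_neg]
    simp only [hf, hc]
    congr! 5
    ring_nf
  rw [latticeBessel, norm_mul, Complex.norm_real, Real.norm_eq_abs, abs_of_pos (by positivity),
    hsplit]
  gcongr
  refine (norm_add_le _ _).trans ?_
  refine (add_le_add_right ((norm_add_le _ _).trans (add_le_add_right (norm_add_le _ _) _)) _).trans
    (le_of_eq ?_)
  rw [h1, h2, h3, h4]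
  ring

theorem norm_latticeBessel_pow_four_le {r s : ℝ} (hr : 1 ≤ r) (hs : r ^ 3 ≤ s) (n : ℤ) :
    ‖latticeBessel s n‖ ^ 4 ≤ 10 ^ 6 / (r ^ 4 + (2 * s - |(n : ℝ)|) ^ 2) := by
  have h1 := norm_besselQuarter_pow_four_le (n := n) hr (show 2 * r ^ 3 ≤ 2 * s by linarith)
  have h2 := norm_besselQuarter_pow_four_le (n := -n) hr (show 2 * r ^ 3 ≤ 2 * s by linarith)
  rw [abs_neg] at h2
  have h := norm_latticeBessel_le_besselQuarter s n
  set u := ‖besselQuarter n (2 * s)‖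
  set v := ‖besselQuarter (-n) (2 * s)‖
  have hu : 0 ≤ u := norm_nonneg _
  have hv : 0 ≤ v := norm_nonneg _
  have hm : ‖latticeBessel s n‖ ≤ max u v := by
    refine h.trans ?_
    have hπ := Real.pi_gt_three
    rw [inv_mul_le_iff₀ (by positivity)]
    have := le_max_left u v
    have := le_max_right u v
    nlinarith
  refine (pow_le_pow_left₀ (norm_nonneg _) hm 4).trans ?_
  rcases max_choice u v with h | h <;> rw [h] <;> assumption

theorem norm_prod_four_le (f : Fin 4 → ℂ) : ‖∏ j, f j‖ ≤ (∑ j, ‖f j‖ ^ 4) / 4 := by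
  rw [norm_prod, Fin.prod_univ_four, Fin.sum_univ_four]
  nlinarith [sq_nonneg (‖f 0‖ * ‖f 1‖ - ‖f 2‖ * ‖f 3‖), sq_nonneg (‖f 0‖ ^ 2 - ‖f 1‖ ^ 2),
    sq_nonneg (‖f 2‖ ^ 2 - ‖f 3‖ ^ 2)]

theorem norm_prod_latticeBessel_le {r s : ℝ} (hr : 1 ≤ r) (hs : r ^ 3 ≤ s) (x : Fin 4 → ℤ) :
    ‖∏ j, latticeBessel s (x j)‖ ≤ 10 ^ 6 / r ^ 4 := by
  have h : ∀ j, ‖latticeBessel s (x j)‖ ^ 4 ≤ 10 ^ 6 / r ^ 4 := fun j =>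
    (norm_latticeBessel_pow_four_le hr hs (x j)).trans (by
      have : 0 < r ^ 4 := by positivity
      gcongr
      nlinarith [sq_nonneg (2 * s - |(x j : ℝ)|)])
  refine (norm_prod_four_le _).trans ?_
  rw [Fin.sum_univ_four]
  linarith [h 0, h 1, h 2, h 3]

theorem integral_inv_sq_add_sq_le {a b c : ℝ} (m : ℝ) (hc : 0 < c) :
    ∫ s in a..b, 1 / (c ^ 2 + (2 * s - m) ^ 2) ≤ 2 / c := by
  have hd : ∀ s, HasDerivAt (fun s => (2 * c)⁻¹ * Real.arctan ((2 * s - m) / c))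
      (1 / (c ^ 2 + (2 * s - m) ^ 2)) s := fun s => by
    have h1 : HasDerivAt (fun s : ℝ => (2 * s - m) / c) (2 / c) s := by
      simpa using (((hasDerivAt_id s).const_mul 2).sub_const m).div_const c
    refine (h1.arctan.const_mul _).congr_deriv ?_
    have : c ^ 2 + (2 * s - m) ^ 2 ≠ 0 := by positivity
    field_simp
  rw [intervalIntegral.integral_eq_sub_of_hasDerivAt (fun s _ => hd s)
    (Continuous.intervalIntegrable (continuous_const.div (by fun_prop)
      fun s => by positivity) _ _), ← mul_sub]
  have h1 := Real.arctan_lt_pi_div_two ((2 * b - m) / c)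
  have h2 := Real.neg_pi_div_two_lt_arctan ((2 * a - m) / c)
  rw [inv_mul_le_iff₀ (by positivity), show 2 * c * (2 / c) = 4 by field_simp; norm_num]
  linarith [Real.pi_le_four]

/-- Averaging in time the four-dimensional lattice propagator over `[a, b]` gains decay over the
pointwise bound. -/
theorem integral_norm_prod_latticeBessel_le {r a b : ℝ} (hr : 1 ≤ r) (ha : r ^ 3 ≤ a)
    (hab : a ≤ b) (x : Fin 4 → ℤ) :
    ∫ s in a..b, ‖∏ j, latticeBessel s (x j)‖ ≤ 2 * 10 ^ 6 / r ^ 2 := by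
  have hr0 : 0 < r := by linarith
  have hc : ∀ m : ℝ, Continuous fun s : ℝ => 1 / ((r ^ 2) ^ 2 + (2 * s - m) ^ 2) := fun m =>
    continuous_const.div (by fun_prop) fun s => by positivity
  have hcb := fun j => continuous_latticeBessel (x j)
  have hint : ∀ j ∈ (Finset.univ : Finset (Fin 4)), IntervalIntegrable
      (fun s => 10 ^ 6 / 4 * (1 / ((r ^ 2) ^ 2 + (2 * s - |(x j : ℝ)|) ^ 2))) volume a b :=
    fun j _ => (continuous_const.mul (hc _)).intervalIntegrable _ _
  calc ∫ s in a..b, ‖∏ j, latticeBessel s (x j)‖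
      ≤ ∫ s in a..b, ∑ j, 10 ^ 6 / 4 * (1 / ((r ^ 2) ^ 2 + (2 * s - |(x j : ℝ)|) ^ 2)) := by
        refine intervalIntegral.integral_mono_on hab
          ((continuous_norm.comp (continuous_finsetProd _ fun j _ => hcb j)).intervalIntegrable
            _ _)
          ((continuous_finsetSum _ fun j _ =>
            continuous_const.mul (hc _)).intervalIntegrable _ _) fun s hs => ?_
        refine (norm_prod_four_le _).trans ?_
        rw [Finset.sum_div]
        refine Finset.sum_le_sum fun j _ => ?_
        have := norm_latticeBessel_pow_four_le hr (ha.trans hs.1) (x j)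
        calc _ ≤ 10 ^ 6 / (r ^ 4 + (2 * s - |(x j : ℝ)|) ^ 2) / 4 := by gcongr
          _ = _ := by rw [← pow_mul]; ring
    _ = ∑ j, 10 ^ 6 / 4 * ∫ s in a..b, 1 / ((r ^ 2) ^ 2 + (2 * s - |(x j : ℝ)|) ^ 2) := by
        rw [intervalIntegral.integral_finsetSum hint]
        simp only [intervalIntegral.integral_const_mul]
    _ ≤ ∑ j : Fin 4, 10 ^ 6 / 4 * (2 / r ^ 2) := by
        gcongr with j
        exact integral_inv_sq_add_sq_le _ (by positivity)
    _ = 2 * 10 ^ 6 / r ^ 2 := by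
        rw [Finset.sum_const, Finset.card_univ, Fintype.card_fin]
        ring

end latticeBessel

/-- The character `ξ ↦ exp (i x·ξ)` of the torus attached to the lattice point `x`. -/
def latticeChar {d : ℕ} (x : Fin d → ℤ) (ξ : Fin d → ℝ) : ℂ :=
  Complex.exp (Complex.I * ((∑ j : Fin d, (x j : ℝ) * ξ j : ℝ) : ℂ))

/-- The Fourier coefficient of a complex symbol over the cube; `multKernel` is the special case of
a real symbol. -/
def cubeCoeff {d : ℕ} (m : (Fin d → ℝ) → ℂ) (x : Fin d → ℤ) : ℂ :=
  ((((2 * π) ^ d)⁻¹ : ℝ) : ℂ) * ∫ ξ in cube d, latticeChar x ξ * m ξ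

section cubeCoeff

variable {d : ℕ}

@[fun_prop]
theorem continuous_latticeChar (x : Fin d → ℤ) : Continuous (latticeChar x) := by
  unfold latticeChar
  fun_prop

theorem norm_latticeChar (x : Fin d → ℤ) (ξ : Fin d → ℝ) : ‖latticeChar x ξ‖ = 1 := by
  rw [latticeChar, mul_comm, Complex.norm_exp_ofReal_mul_I]

theorem latticeChar_zero (ξ : Fin d → ℝ) : latticeChar 0 ξ = 1 := by
  simp [latticeChar]

theorem latticeChar_add (x y : Fin d → ℤ) (ξ : Fin d → ℝ) :
    latticeChar (x + y) ξ = latticeChar x ξ * latticeChar y ξ := by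
  simp only [latticeChar, ← Complex.exp_add, ← mul_add, ← Complex.ofReal_add,
    ← Finset.sum_add_distrib, Pi.add_apply, Int.cast_add, add_mul]

theorem conj_latticeChar (x : Fin d → ℤ) (ξ : Fin d → ℝ) :
    (starRingEnd ℂ) (latticeChar x ξ) = latticeChar (-x) ξ := by
  simp only [latticeChar, ← Complex.exp_conj, map_mul, Complex.conj_I, Complex.conj_ofReal,
    Pi.neg_apply, Int.cast_neg, neg_mul, Finset.sum_neg_distrib, Complex.ofReal_neg, mul_neg]

theorem latticeChar_eq_prod (x : Fin d → ℤ) (ξ : Fin d → ℝ) :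
    latticeChar x ξ = ∏ j, Complex.exp (Complex.I * ((x j * ξ j : ℝ) : ℂ)) := by
  rw [latticeChar, ← Complex.exp_sum, ← Finset.mul_sum, Complex.ofReal_sum]

theorem integrableOn_cube {m : (Fin d → ℝ) → ℂ} (hm : Continuous m) :
    IntegrableOn m (cube d) :=
  hm.integrableOn_Icc

theorem integrableOn_latticeChar_mul {m : (Fin d → ℝ) → ℂ} (hm : Continuous m) (x : Fin d → ℤ) :
    IntegrableOn (fun ξ => latticeChar x ξ * m ξ) (cube d) :=
  integrableOn_cube (by fun_prop)

theorem cubeCoeff_add {m n : (Fin d → ℝ) → ℂ} (hm : Continuous m) (hn : Continuous n)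
    (x : Fin d → ℤ) : cubeCoeff (fun ξ => m ξ + n ξ) x = cubeCoeff m x + cubeCoeff n x := by
  simp only [cubeCoeff, mul_add]
  rw [integral_add (integrableOn_latticeChar_mul hm x)
    (integrableOn_latticeChar_mul hn x), mul_add]

theorem cubeCoeff_const_mul (c : ℂ) (m : (Fin d → ℝ) → ℂ) (x : Fin d → ℤ) :
    cubeCoeff (fun ξ => c * m ξ) x = c * cubeCoeff m x := by
  simp only [cubeCoeff, mul_left_comm _ c]
  rw [integral_const_mul, mul_left_comm]

theorem cubeCoeff_sub {m n : (Fin d → ℝ) → ℂ} (hm : Continuous m) (hn : Continuous n)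
    (x : Fin d → ℤ) : cubeCoeff (fun ξ => m ξ - n ξ) x = cubeCoeff m x - cubeCoeff n x := by
  simp only [cubeCoeff, mul_sub]
  rw [integral_sub (integrableOn_latticeChar_mul hm x)
    (integrableOn_latticeChar_mul hn x), mul_sub]

theorem cubeCoeff_finsetSum {ι : Type*} (s : Finset ι) {m : ι → (Fin d → ℝ) → ℂ}
    (hm : ∀ i, Continuous (m i)) (x : Fin d → ℤ) :
    cubeCoeff (fun ξ => ∑ i ∈ s, m i ξ) x = ∑ i ∈ s, cubeCoeff (m i) x := by
  simp only [cubeCoeff, Finset.mul_sum]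
  rw [integral_finsetSum _ fun i _ => integrableOn_latticeChar_mul (hm i) x,
    Finset.mul_sum]

theorem cubeCoeff_latticeChar_mul (m : (Fin d → ℝ) → ℂ) (x y : Fin d → ℤ) :
    cubeCoeff (fun ξ => latticeChar y ξ * m ξ) x = cubeCoeff m (x + y) := by
  simp only [cubeCoeff, ← mul_assoc, latticeChar_add]

theorem volume_real_cube : volume.real (cube d) = (2 * π) ^ d := by
  have h : (0 : Fin d → ℝ) ≤ fun _ => 2 * π := fun _ => by simp [Real.pi_pos.le]
  rw [measureReal_def, cube, Real.volume_Icc_pi_toReal h]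
  simp

theorem norm_cubeCoeff_le {m : (Fin d → ℝ) → ℂ} {B : ℝ} (hm : ∀ ξ, ‖m ξ‖ ≤ B)
    (x : Fin d → ℤ) : ‖cubeCoeff m x‖ ≤ B := by
  have hπ := Real.pi_pos
  have h : ‖∫ ξ in cube d, latticeChar x ξ * m ξ‖ ≤ B * volume.real (cube d) :=
    norm_setIntegral_le_of_norm_le_const (isCompact_Icc.measure_lt_top) fun ξ _ => by
      rw [norm_mul, norm_latticeChar, one_mul]; exact hm ξ
  rw [cubeCoeff, norm_mul, Complex.norm_real, Real.norm_eq_abs, abs_of_pos (by positivity),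
    inv_mul_le_iff₀ (by positivity), mul_comm]
  rwa [volume_real_cube] at h

theorem cubeCoeff_prod (g : Fin d → ℝ → ℂ) (x : Fin d → ℤ) :
    cubeCoeff (fun ξ => ∏ j, g j (ξ j)) x = ∏ j, ((((2 * π)⁻¹ : ℝ) : ℂ) *
      ∫ t in (0:ℝ)..2 * π, Complex.exp (Complex.I * ((x j * t : ℝ) : ℂ)) * g j t) := by
  have hπ := Real.pi_pos
  simp only [cubeCoeff, latticeChar_eq_prod, ← Finset.prod_mul_distrib]
  rw [cube, ← Set.pi_univ_Icc, volume_pi, Measure.restrict_pi_pi, integral_fintype_prod_eq_prod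
    (f := fun j t => Complex.exp (Complex.I * ((x j * t : ℝ) : ℂ)) * g j t),
    Finset.prod_mul_distrib]
  congr 1
  · rw [Finset.prod_const, Finset.card_univ, Fintype.card_fin, ← inv_pow, Complex.ofReal_pow]
  · refine Finset.prod_congr rfl fun j _ => ?_
    rw [intervalIntegral.integral_of_le (by positivity), integral_Icc_eq_integral_Ioc]
    rfl

theorem integral_exp_int_mul (n : ℤ) :
    ∫ t in (0:ℝ)..2 * π, Complex.exp (Complex.I * ((n * t : ℝ) : ℂ)) =
      if n = 0 then ((2 * π : ℝ) : ℂ) else 0 := by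
  split_ifs with h
  · simp [h]
  · have hc : Complex.I * n ≠ 0 := mul_ne_zero Complex.I_ne_zero (by exact_mod_cast h)
    have := integral_exp_mul_complex (a := 0) (b := 2 * π) hc
    simp only [Complex.ofReal_mul, ← mul_assoc, Complex.ofReal_intCast]
    rw [this]
    have h1 : Complex.exp (Complex.I * n * ((2 * π : ℝ) : ℂ)) = 1 := by
      rw [Complex.exp_eq_one_iff]
      exact ⟨n, by push_cast; ring⟩
    rw [h1]
    simp

theorem cubeCoeff_one (x : Fin d → ℤ) :
    cubeCoeff (fun _ => 1) x = if x = 0 then 1 else 0 := by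
  have h := cubeCoeff_prod (fun _ _ => 1) x
  simp only [Finset.prod_const_one, mul_one, integral_exp_int_mul] at h
  rw [h]
  have hπ := Real.pi_pos
  split_ifs with hx
  · subst hx
    simp only [Pi.zero_apply, if_true, ← Complex.ofReal_mul]
    rw [inv_mul_cancel₀ (by positivity)]
    simp
  · obtain ⟨j, hj⟩ := Function.ne_iff.1 hx
    refine Finset.prod_eq_zero (Finset.mem_univ j) ?_
    rw [if_neg (by simpa using hj), mul_zero]

theorem cubeCoeff_sum_latticeChar (S : Finset (Fin d → ℤ)) (g : (Fin d → ℤ) → ℂ)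
    {m : (Fin d → ℝ) → ℂ} (hm : Continuous m) (x : Fin d → ℤ) :
    cubeCoeff (fun ξ => (∑ y ∈ S, g y * latticeChar (-y) ξ) * m ξ) x =
      ∑ y ∈ S, cubeCoeff m (x - y) * g y := by
  simp only [Finset.sum_mul, mul_assoc]
  rw [cubeCoeff_finsetSum S (m := fun y ξ => g y * (latticeChar (-y) ξ * m ξ))
    (fun y => by fun_prop)]
  refine Finset.sum_congr rfl fun y _ => ?_
  rw [cubeCoeff_const_mul, cubeCoeff_latticeChar_mul, sub_eq_add_neg, mul_comm]

theorem cubeCoeff_zero_re_mono {m n : (Fin d → ℝ) → ℝ} (hm : Continuous m) (hn : Continuous n)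
    (h : ∀ ξ, m ξ ≤ n ξ) :
    (cubeCoeff (fun ξ => (m ξ : ℂ)) 0).re ≤ (cubeCoeff (fun ξ => (n ξ : ℂ)) 0).re := by
  have hπ := Real.pi_pos
  simp only [cubeCoeff, latticeChar_zero, one_mul, integral_complex_ofReal, ← Complex.ofReal_mul,
    Complex.ofReal_re]
  have hi : IntegrableOn m (cube d) := hm.integrableOn_Icc
  have hi' : IntegrableOn n (cube d) := hn.integrableOn_Icc
  exact mul_le_mul_of_nonneg_left (setIntegral_mono hi hi' h) (by positivity)

/-- Bessel's inequality for the Fourier coefficients of a continuous function. -/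
theorem sum_norm_sq_cubeCoeff_le {m : (Fin d → ℝ) → ℂ} (hm : Continuous m)
    (F : Finset (Fin d → ℤ)) :
    ∑ x ∈ F, ‖cubeCoeff m x‖ ^ 2 ≤ (cubeCoeff (fun ξ => ((‖m ξ‖ ^ 2 : ℝ) : ℂ)) 0).re := by
  set c := cubeCoeff m
  set T : (Fin d → ℝ) → ℂ := fun ξ => ∑ y ∈ F, c y * latticeChar (-y) ξ with hT
  have hTc : Continuous T :=
    continuous_finsetSum _ fun y _ => continuous_const.mul (continuous_latticeChar _)
  have hcj : ∀ n : (Fin d → ℝ) → ℂ, Continuous n →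
      cubeCoeff (fun ξ => (starRingEnd ℂ) (T ξ) * n ξ) 0 =
        ∑ y ∈ F, (starRingEnd ℂ) (c y) * cubeCoeff n y := by
    intro n hn
    simp only [hT, map_sum, map_mul, conj_latticeChar, neg_neg, Finset.sum_mul, mul_assoc]
    rw [cubeCoeff_finsetSum F (m := fun y ξ => (starRingEnd ℂ) (c y) * (latticeChar y ξ * n ξ))
      (fun y => by fun_prop)]
    refine Finset.sum_congr rfl fun y _ => ?_
    rw [cubeCoeff_const_mul, cubeCoeff_latticeChar_mul, zero_add]
  have hTcoeff : ∀ x ∈ F, cubeCoeff T x = c x := by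
    intro x hx
    have := cubeCoeff_sum_latticeChar F c (m := fun _ => 1) continuous_const x
    simp only [mul_one] at this
    rw [hT, this, Finset.sum_eq_single x]
    · simp [cubeCoeff_one]
    · intro y _ hy
      rw [cubeCoeff_one, if_neg (sub_ne_zero.2 hy.symm), zero_mul]
    · exact fun h => absurd hx h
  have hsq : ∀ y, (starRingEnd ℂ) (c y) * c y = ((‖c y‖ ^ 2 : ℝ) : ℂ) := fun y => by
    rw [mul_comm, Complex.mul_conj, Complex.normSq_eq_norm_sq]
  have h1 : cubeCoeff (fun ξ => (starRingEnd ℂ) (T ξ) * m ξ) 0 =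
      ((∑ y ∈ F, ‖c y‖ ^ 2 : ℝ) : ℂ) := by
    rw [hcj m hm, Complex.ofReal_sum]
    exact Finset.sum_congr rfl fun y _ => hsq y
  have h2 : cubeCoeff (fun ξ => (starRingEnd ℂ) (T ξ) * T ξ) 0 =
      ((∑ y ∈ F, ‖c y‖ ^ 2 : ℝ) : ℂ) := by
    rw [hcj T hTc, Complex.ofReal_sum]
    exact Finset.sum_congr rfl fun y hy => by rw [hTcoeff y hy, hsq]
  have hre : ∀ n : (Fin d → ℝ) → ℂ, Continuous n →
      (cubeCoeff n 0).re = (cubeCoeff (fun ξ => ((n ξ).re : ℂ)) 0).re := by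
    intro n hn
    have hi : IntegrableOn n (cube d) := integrableOn_cube hn
    simp only [cubeCoeff, latticeChar_zero, one_mul, integral_complex_ofReal,
      Complex.re_ofReal_mul, Complex.ofReal_re]
    congr 1
    exact (integral_re hi).symm
  have h3 : (cubeCoeff (fun ξ => (starRingEnd ℂ) (T ξ) * m ξ) 0 +
      cubeCoeff (fun ξ => (starRingEnd ℂ) (T ξ) * m ξ) 0 -
      cubeCoeff (fun ξ => (starRingEnd ℂ) (T ξ) * T ξ) 0).re ≤
      (cubeCoeff (fun ξ => ((‖m ξ‖ ^ 2 : ℝ) : ℂ)) 0).re := by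
    have hs : Continuous fun ξ => (starRingEnd ℂ) (T ξ) := Complex.continuous_conj.comp hTc
    rw [← cubeCoeff_add (m := fun ξ => (starRingEnd ℂ) (T ξ) * m ξ)
      (n := fun ξ => (starRingEnd ℂ) (T ξ) * m ξ) (by fun_prop) (by fun_prop), ← cubeCoeff_sub
      (m := fun ξ => (starRingEnd ℂ) (T ξ) * m ξ + (starRingEnd ℂ) (T ξ) * m ξ)
      (n := fun ξ => (starRingEnd ℂ) (T ξ) * T ξ) (by fun_prop) (by fun_prop), hre _ (by fun_prop)]
    refine cubeCoeff_zero_re_mono (by fun_prop) (by fun_prop) fun ξ => ?_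
    have h0 := sq_nonneg (m ξ - T ξ).re
    have h0' := sq_nonneg (m ξ - T ξ).im
    simp only [Complex.sub_re, Complex.sub_im] at h0 h0'
    rw [← Complex.normSq_eq_norm_sq, Complex.normSq_apply]
    simp only [Complex.sub_re, Complex.add_re, Complex.mul_re, Complex.conj_re, Complex.conj_im]
    nlinarith
  rwa [h1, h2, add_sub_cancel_right, Complex.ofReal_re] at h3

theorem cubeCoeff_norm_sq_trigPoly (S : Finset (Fin d → ℤ)) (g : (Fin d → ℤ) → ℂ) :
    cubeCoeff (fun ξ => ((‖∑ y ∈ S, g y * latticeChar (-y) ξ‖ ^ 2 : ℝ) : ℂ)) 0 =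
      ((∑ y ∈ S, ‖g y‖ ^ 2 : ℝ) : ℂ) := by
  have h : ∀ ξ, ((‖∑ y ∈ S, g y * latticeChar (-y) ξ‖ ^ 2 : ℝ) : ℂ) =
      (∑ y ∈ S, g y * latticeChar (-y) ξ) *
        ∑ y ∈ S, (starRingEnd ℂ) (g y) * latticeChar y ξ := fun ξ => by
    rw [← Complex.normSq_eq_norm_sq, Complex.normSq_eq_conj_mul_self, mul_comm]
    simp only [map_sum, map_mul, conj_latticeChar, neg_neg]
  simp only [h]
  rw [cubeCoeff_sum_latticeChar S g
    (m := fun ξ => ∑ y ∈ S, (starRingEnd ℂ) (g y) * latticeChar y ξ) (by fun_prop),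
    Complex.ofReal_sum]
  refine Finset.sum_congr rfl fun y hy => ?_
  have h1 : cubeCoeff (fun ξ => ∑ z ∈ S, (starRingEnd ℂ) (g z) * latticeChar z ξ) (0 - y) =
      ∑ z ∈ S, (starRingEnd ℂ) (g z) * cubeCoeff (fun _ => 1) (z - y) := by
    rw [cubeCoeff_finsetSum S (m := fun z ξ => (starRingEnd ℂ) (g z) * latticeChar z ξ)
      (fun z => by fun_prop)]
    refine Finset.sum_congr rfl fun z _ => ?_
    have := cubeCoeff_latticeChar_mul (fun _ => 1) (0 - y) z
    simp only [mul_one] at this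
    rw [cubeCoeff_const_mul, this, show 0 - y + z = z - y by abel]
  rw [h1, Finset.sum_eq_single y]
  · rw [cubeCoeff_one, if_pos (sub_self y), mul_one, mul_comm, Complex.mul_conj,
      Complex.normSq_eq_norm_sq]
  · intro z _ hz
    rw [cubeCoeff_one, if_neg (sub_ne_zero.2 hz), mul_zero]
  · exact fun h => absurd hy h

/-- A bounded continuous symbol acts boundedly on square-summable sequences. -/
theorem sum_norm_sq_multiplier_le {m : (Fin d → ℝ) → ℂ} (hm : Continuous m) {L : ℝ}
    (hL : ∀ ξ, ‖m ξ‖ ≤ L) (S F : Finset (Fin d → ℤ)) (g : (Fin d → ℤ) → ℂ) :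
    ∑ x ∈ F, ‖∑ y ∈ S, cubeCoeff m (x - y) * g y‖ ^ 2 ≤ L ^ 2 * ∑ y ∈ S, ‖g y‖ ^ 2 := by
  have hTc : Continuous fun ξ => ∑ y ∈ S, g y * latticeChar (-y) ξ :=
    continuous_finsetSum _ fun y _ => continuous_const.mul (continuous_latticeChar _)
  simp only [← cubeCoeff_sum_latticeChar S g hm]
  refine (sum_norm_sq_cubeCoeff_le
    (m := fun ξ => (∑ y ∈ S, g y * latticeChar (-y) ξ) * m ξ) (by fun_prop) F).trans ?_
  have h := cubeCoeff_const_mul ((L ^ 2 : ℝ) : ℂ)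
    (fun ξ => ((‖∑ y ∈ S, g y * latticeChar (-y) ξ‖ ^ 2 : ℝ) : ℂ)) 0
  rw [cubeCoeff_norm_sq_trigPoly, ← Complex.ofReal_mul] at h
  simp only [← Complex.ofReal_mul] at h
  rw [← Complex.ofReal_re (L ^ 2 * ∑ y ∈ S, ‖g y‖ ^ 2), ← h]
  refine cubeCoeff_zero_re_mono (by fun_prop) (by fun_prop) fun ξ => ?_
  rw [norm_mul, mul_pow, mul_comm]
  gcongr
  exact hL ξ

theorem cubeCoeff_intervalIntegral {a b : ℝ} (hab : a ≤ b) {F : ℝ → (Fin d → ℝ) → ℂ}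
    (hF : Continuous fun p : ℝ × (Fin d → ℝ) => F p.1 p.2) (x : Fin d → ℤ) :
    cubeCoeff (fun ξ => ∫ s in a..b, F s ξ) x = ∫ s in a..b, cubeCoeff (F s) x := by
  have hc : Continuous fun p : ℝ × (Fin d → ℝ) => latticeChar x p.2 * F p.1 p.2 :=
    ((continuous_latticeChar x).comp continuous_snd).mul hF
  simp only [cubeCoeff, ← intervalIntegral.integral_const_mul]
  rw [intervalIntegral.integral_const_mul]
  simp only [intervalIntegral.integral_of_le hab]
  congr 1
  refine (integral_integral_swap ?_).symm
  rw [Measure.prod_restrict]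
  refine IntegrableOn.mono_set (t := Set.Icc a b ×ˢ cube d) ?_
    (Set.prod_mono Set.Ioc_subset_Icc_self le_rfl)
  exact hc.continuousOn.integrableOn_compact (isCompact_Icc.prod isCompact_Icc)

end cubeCoeff

/-- The `ℓ^p` norm of the restriction of a function to a finite set. -/
def finLp {G : Type*} (p : ℝ) (F : Finset G) (u : G → ℂ) : ℝ :=
  (∑ x ∈ F, ‖u x‖ ^ p) ^ (1 / p)

section finLp

variable {G : Type*}

theorem finLp_nonneg (p : ℝ) (F : Finset G) (u : G → ℂ) : 0 ≤ finLp p F u := by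
  unfold finLp
  positivity

theorem finLp_add_le {p : ℝ} (hp : 1 ≤ p) (F : Finset G) (u v : G → ℂ) :
    finLp p F (fun x => u x + v x) ≤ finLp p F u + finLp p F v := by
  have h := Real.Lp_add_le F (fun x => ‖u x‖) (fun x => ‖v x‖) hp
  simp only [abs_norm] at h
  refine le_trans ?_ h
  unfold finLp
  gcongr with x
  exact (norm_add_le _ _).trans (le_abs_self _)

theorem finLp_zero {p : ℝ} (hp : 0 < p) (F : Finset G) : finLp p F (fun _ => 0) = 0 := by
  simp [finLp, Real.zero_rpow hp.ne', hp.ne']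

theorem finLp_sum_le {ι : Type*} {p : ℝ} (hp : 1 ≤ p) (F : Finset G) (s : Finset ι)
    (u : ι → G → ℂ) : finLp p F (fun x => ∑ i ∈ s, u i x) ≤ ∑ i ∈ s, finLp p F (u i) := by
  classical
  induction s using Finset.induction_on with
  | empty => simp [finLp_zero (zero_lt_one.trans_le hp)]
  | insert i s hi ih =>
    simp only [Finset.sum_insert hi]
    exact (finLp_add_le hp F _ _).trans (by gcongr)

theorem finLp_le_of_sum_le {n : ℕ} (hn : n ≠ 0) {F : Finset G} {u : G → ℂ} {D : ℝ} (hD : 0 ≤ D)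
    (h : ∑ x ∈ F, ‖u x‖ ^ n ≤ D ^ n) : finLp n F u ≤ D := by
  unfold finLp
  simp only [Real.rpow_natCast, one_div]
  calc _ ≤ (D ^ n) ^ ((n : ℝ)⁻¹) := by gcongr
    _ = D := Real.pow_rpow_inv_natCast hD hn

theorem finLp_rpow {p : ℝ} (hp : 0 < p) (F : Finset G) (u : G → ℂ) :
    finLp p F u ^ p = ∑ x ∈ F, ‖u x‖ ^ p := by
  rw [finLp, ← Real.rpow_mul (by positivity), one_div_mul_cancel hp.ne', Real.rpow_one]

theorem norm_le_finLp {p : ℝ} (hp : 0 < p) {F : Finset G} (u : G → ℂ) {x : G} (hx : x ∈ F) :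
    ‖u x‖ ≤ finLp p F u := by
  rw [← Real.rpow_le_rpow_iff (norm_nonneg _) (finLp_nonneg _ _ _) hp, finLp_rpow hp]
  exact Finset.single_le_sum (f := fun x => ‖u x‖ ^ p) (fun x _ => by positivity) hx

end finLp

section interpolation

variable {G : Type*} [AddCommGroup G] {κ : G → ℂ} {B L : ℝ}

theorem sum_norm_pow_six_convolution_le (hB : ∀ x, ‖κ x‖ ≤ B)
    (hL : ∀ (S F : Finset G) (g : G → ℂ),
      ∑ x ∈ F, ‖∑ y ∈ S, κ (x - y) * g y‖ ^ 2 ≤ L ^ 2 * ∑ y ∈ S, ‖g y‖ ^ 2)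
    {S : Finset G} (F : Finset G) {g : G → ℂ} {a N : ℝ} (ha : ∀ y ∈ S, ‖g y‖ ≤ a) (ha0 : 0 ≤ a)
    (hN : (S.card : ℝ) ≤ N) :
    ∑ x ∈ F, ‖∑ y ∈ S, κ (x - y) * g y‖ ^ 6 ≤ L ^ 2 * B ^ 4 * (a ^ 6 * N ^ 5) := by
  have hB0 : 0 ≤ B := (norm_nonneg _).trans (hB 0)
  have hN0 : 0 ≤ N := (Nat.cast_nonneg _).trans hN
  have hsup : ∀ x, ‖∑ y ∈ S, κ (x - y) * g y‖ ≤ B * a * N := fun x => by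
    calc ‖∑ y ∈ S, κ (x - y) * g y‖ ≤ ∑ y ∈ S, B * a := by
          refine (norm_sum_le _ _).trans (Finset.sum_le_sum fun y hy => ?_)
          rw [norm_mul]
          exact mul_le_mul (hB _) (ha y hy) (norm_nonneg _) hB0
      _ = B * a * S.card := by rw [Finset.sum_const, nsmul_eq_mul, mul_comm]
      _ ≤ B * a * N := by gcongr
  have hg : ∑ y ∈ S, ‖g y‖ ^ 2 ≤ N * a ^ 2 := by
    calc ∑ y ∈ S, ‖g y‖ ^ 2 ≤ ∑ y ∈ S, a ^ 2 := Finset.sum_le_sum fun y hy => by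
          have := ha y hy
          gcongr
      _ = S.card * a ^ 2 := by rw [Finset.sum_const, nsmul_eq_mul]
      _ ≤ N * a ^ 2 := by gcongr
  calc ∑ x ∈ F, ‖∑ y ∈ S, κ (x - y) * g y‖ ^ 6
      ≤ ∑ x ∈ F, (B * a * N) ^ 4 * ‖∑ y ∈ S, κ (x - y) * g y‖ ^ 2 := by
        refine Finset.sum_le_sum fun x _ => ?_
        rw [show (6 : ℕ) = 4 + 2 from rfl, pow_add]
        have := hsup x
        gcongr
    _ ≤ (B * a * N) ^ 4 * (L ^ 2 * (N * a ^ 2)) := by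
        rw [← Finset.mul_sum]
        refine mul_le_mul_of_nonneg_left ((hL S F g).trans ?_) (by positivity)
        gcongr
    _ = L ^ 2 * B ^ 4 * (a ^ 6 * N ^ 5) := by ring

/-- The constant in `finLp_six_convolution_le`. -/
def interpConst (p : ℝ) : ℝ := 2 ^ (5 * p / 6) * (1 - 2 ^ (5 * p / 6 - 1))⁻¹

theorem two_rpow_lt_one {p : ℝ} (hp : p < 6 / 5) : (2:ℝ) ^ (5 * p / 6 - 1) < 1 :=
  Real.rpow_lt_one_of_one_lt_of_neg one_lt_two (by linarith)

theorem interpConst_pos {p : ℝ} (hp : p < 6 / 5) : 0 < interpConst p :=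
  mul_pos (by positivity) (inv_pos.2 (sub_pos.2 (two_rpow_lt_one hp)))

/-- A convolution operator bounded on `ℓ²` with bounded kernel maps `ℓ^p` to `ℓ⁶` for `p < 6/5`. -/
theorem finLp_six_convolution_le (hB : ∀ x, ‖κ x‖ ≤ B)
    (hL : ∀ (S F : Finset G) (g : G → ℂ),
      ∑ x ∈ F, ‖∑ y ∈ S, κ (x - y) * g y‖ ^ 2 ≤ L ^ 2 * ∑ y ∈ S, ‖g y‖ ^ 2)
    {D : ℝ} (hD0 : 0 ≤ D) (hD : L ^ 2 * B ^ 4 ≤ D ^ 6) {p : ℝ} (hp0 : 0 < p) (hp : p < 6 / 5)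
    (S F : Finset G) (g : G → ℂ) :
    finLp 6 F (fun x => ∑ y ∈ S, κ (x - y) * g y) ≤ D * (interpConst p * finLp p S g) := by
  classical
  set A := finLp p S g with hA
  have hA0 : 0 ≤ A := finLp_nonneg _ _ _
  have hc0 := interpConst_pos hp
  set S' := S.filter fun y => g y ≠ 0 with hS'
  have hgA : ∀ y ∈ S', 0 < ‖g y‖ / A ∧ ‖g y‖ / A ≤ 1 := by
    intro y hy
    obtain ⟨hyS, hy0⟩ := Finset.mem_filter.1 hy
    have h1 : 0 < ‖g y‖ := norm_pos_iff.2 hy0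
    have h2 : ‖g y‖ ≤ A := norm_le_finLp hp0 g hyS
    exact ⟨div_pos h1 (h1.trans_le h2), div_le_one_of_le₀ h2 hA0⟩
  have hlev : ∀ y, ∃ n : ℕ, y ∈ S' →
      (1 / 2 : ℝ) ^ (n + 1) < ‖g y‖ / A ∧ ‖g y‖ / A ≤ (1 / 2 : ℝ) ^ n := by
    intro y
    by_cases hy : y ∈ S'
    · obtain ⟨n, h1, h2⟩ := exists_nat_pow_near_of_lt_one (hgA y hy).1 (hgA y hy).2
        (show (0:ℝ) < 1 / 2 by norm_num) (by norm_num)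
      exact ⟨n, fun _ => ⟨h1, h2⟩⟩
    · exact ⟨0, fun h => absurd h hy⟩
  choose ℓ hℓ using hlev
  set K := S'.sup ℓ + 1
  have hmaps : ∀ y ∈ S', ℓ y ∈ Finset.range K := fun y hy =>
    Finset.mem_range.2 (Nat.lt_succ_of_le (Finset.le_sup hy))
  set c : ℝ := 2 ^ (5 * p / 6) with hc
  set ρ : ℝ := 2 ^ (5 * p / 6 - 1) with hρ
  have hc1 : 0 < c := by positivity
  have hρ0 : 0 < ρ := by positivity
  have hρ1 : ρ < 1 := two_rpow_lt_one hp
  have hpiece : ∀ m, finLp 6 F (fun x => ∑ y ∈ S' with ℓ y = m, κ (x - y) * g y) ≤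
      D * (A * (c * ρ ^ m)) := by
    intro m
    rcases (S'.filter fun y => ℓ y = m).eq_empty_or_nonempty with he | ⟨y₀, hy₀⟩
    · rw [he]
      simp only [Finset.sum_empty, finLp_zero (show (0:ℝ) < 6 by norm_num)]
      positivity
    have hApos : 0 < A := by
      have := (hgA y₀ (Finset.mem_filter.1 hy₀).1).1
      exact hA0.lt_of_ne' fun h => by simp [h] at this
    have hcard : ((S'.filter fun y => ℓ y = m).card : ℝ) ≤ 2 ^ ((m + 1 : ℝ) * p) := by
      have h1 : ((S'.filter fun y => ℓ y = m).card : ℝ) * (A * (1 / 2) ^ (m + 1)) ^ p ≤ A ^ p := by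
        rw [finLp_rpow hp0, ← nsmul_eq_mul]
        refine (Finset.card_nsmul_le_sum _ (fun y => ‖g y‖ ^ p) _ fun y hy => ?_).trans
          (Finset.sum_le_sum_of_subset_of_nonneg
            ((Finset.filter_subset _ _).trans (Finset.filter_subset _ _))
            fun _ _ _ => by positivity)
        obtain ⟨hy1, hy2⟩ := Finset.mem_filter.1 hy
        have := (hℓ y hy1).1
        rw [hy2, lt_div_iff₀ hApos] at this
        rw [mul_comm A]
        gcongr
      rw [Real.mul_rpow hA0 (by positivity), mul_left_comm] at h1
      have h2 := (mul_le_iff_le_one_right (Real.rpow_pos_of_pos hApos p)).1 h1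
      have h3 : ((1 / 2 : ℝ) ^ (m + 1)) ^ p = (2 ^ ((m + 1 : ℝ) * p))⁻¹ := by
        rw [Real.rpow_mul zero_le_two, ← Real.inv_rpow (by positivity)]
        congr 1
        rw [one_div, inv_pow]
        norm_cast
      rw [h3] at h2
      rwa [← div_eq_mul_inv, div_le_one (by positivity)] at h2
    have ha : ∀ y ∈ S'.filter fun y => ℓ y = m, ‖g y‖ ≤ A * (1 / 2) ^ m := by
      intro y hy
      obtain ⟨hy1, hy2⟩ := Finset.mem_filter.1 hy
      have := (hℓ y hy1).2
      rwa [hy2, div_le_iff₀ hApos, mul_comm] at this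
    refine finLp_le_of_sum_le (n := 6) (by norm_num) (by positivity) ?_
    refine (sum_norm_pow_six_convolution_le hB hL F ha (by positivity) hcard).trans ?_
    have h5 : (A * (1 / 2) ^ m) ^ 6 * (2 ^ ((m + 1 : ℝ) * p)) ^ 5 = (A * (c * ρ ^ m)) ^ 6 := by
      have h6 : ((1 / 2 : ℝ) ^ m) = 2 ^ (-(m : ℝ)) := by
        rw [Real.rpow_neg zero_le_two, Real.rpow_natCast, one_div, inv_pow]
      rw [mul_pow, mul_pow, mul_assoc, h6, hc, hρ]
      congr 1
      simp only [← Real.rpow_natCast, ← Real.rpow_mul zero_le_two, ← Real.rpow_add two_pos]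
      congr 1
      push_cast
      ring
    rw [h5, mul_pow D]
    gcongr
  have hsplit : ∀ x, ∑ y ∈ S, κ (x - y) * g y =
      ∑ m ∈ Finset.range K, ∑ y ∈ S' with ℓ y = m, κ (x - y) * g y := by
    intro x
    rw [Finset.sum_fiberwise_of_maps_to hmaps, hS', Finset.sum_filter]
    refine Finset.sum_congr rfl fun y _ => ?_
    split_ifs with h
    · rfl
    · rw [not_not.1 h, mul_zero]
  simp only [hsplit]
  calc _ ≤ ∑ m ∈ Finset.range K, D * (A * (c * ρ ^ m)) :=
        (finLp_sum_le (by norm_num) F _ _).trans (Finset.sum_le_sum fun m _ => hpiece m)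
    _ = D * (A * (c * ∑ m ∈ Finset.range K, ρ ^ m)) := by simp only [Finset.mul_sum]
    _ ≤ D * (A * (c * (1 - ρ)⁻¹)) := by
        gcongr
        rw [← tsum_geometric_of_lt_one hρ0.le hρ1]
        exact (summable_geometric_of_lt_one hρ0.le hρ1).sum_le_tsum _ fun _ _ => by positivity
    _ = D * (interpConst p * A) := by rw [interpConst, mul_comm A]

end interpolation

/-- The adjacency operator of `ℤ^d`. -/
def latticeAdj {d : ℕ} (ψ : (Fin d → ℤ) → ℂ) (x : Fin d → ℤ) : ℂ :=
  ∑ j, (ψ (x + Pi.single j 1) + ψ (x - Pi.single j 1))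

/-- The Fourier symbol of the adjacency operator of `ℤ^d`. -/
def adjSymbol {d : ℕ} (ξ : Fin d → ℝ) : ℝ := ∑ j, 2 * Real.cos (ξ j)

section latticeAdj

variable {d : ℕ}

@[fun_prop]
theorem continuous_adjSymbol : Continuous (adjSymbol (d := d)) := by
  unfold adjSymbol
  fun_prop

theorem adjSymbol_eq_sum_latticeChar (ξ : Fin d → ℝ) :
    (adjSymbol ξ : ℂ) = ∑ j, (latticeChar (Pi.single j 1) ξ + latticeChar (-Pi.single j 1) ξ) := by
  rw [adjSymbol, Complex.ofReal_sum]
  refine Finset.sum_congr rfl fun j _ => ?_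
  have h : ∑ i, ((Pi.single j 1 : Fin d → ℤ) i : ℝ) * ξ i = ξ j := by
    rw [Finset.sum_eq_single j] <;> simp +contextual
  have h' : ∑ i, ((-Pi.single j 1 : Fin d → ℤ) i : ℝ) * ξ i = -ξ j := by
    simp only [Pi.neg_apply, Int.cast_neg, neg_mul, Finset.sum_neg_distrib, h]
  rw [latticeChar, latticeChar, h, h', Complex.ofReal_mul, Complex.ofReal_cos, Complex.ofReal_ofNat,
    Complex.two_cos, mul_comm Complex.I, mul_comm Complex.I, Complex.ofReal_neg]

theorem cubeCoeff_adjSymbol_mul {m : (Fin d → ℝ) → ℂ} (hm : Continuous m) (x : Fin d → ℤ) :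
    cubeCoeff (fun ξ => (adjSymbol ξ : ℂ) * m ξ) x = latticeAdj (cubeCoeff m) x := by
  simp only [adjSymbol_eq_sum_latticeChar, Finset.sum_mul, add_mul]
  rw [cubeCoeff_finsetSum Finset.univ (m := fun j ξ => latticeChar (Pi.single j 1) ξ * m ξ +
    latticeChar (-Pi.single j 1) ξ * m ξ) (fun j => by fun_prop), latticeAdj]
  refine Finset.sum_congr rfl fun j _ => ?_
  rw [cubeCoeff_add (by fun_prop) (by fun_prop), cubeCoeff_latticeChar_mul,
    cubeCoeff_latticeChar_mul, sub_eq_add_neg]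

theorem summable_mul_of_finite_support {G : Type*} {ψ : G → ℂ} (hψ : ψ.support.Finite)
    (κ : G → ℂ) : Summable fun y => κ y * ψ y :=
  summable_of_hasFiniteSupport (hψ.subset (Function.support_mul_subset_right _ _))

theorem finite_support_comp_add {G : Type*} [AddGroup G] {ψ : G → ℂ} (hψ : ψ.support.Finite)
    (e : G) : (fun y => ψ (y + e)).support.Finite :=
  hψ.preimage (f := fun y => y + e) (add_left_injective e).injOn

theorem tsum_sub_mul_comp_add {G : Type*} [AddCommGroup G] (κ ψ : G → ℂ) (x e : G) :
    ∑' y, κ (x - y) * ψ (y + e) = ∑' y, κ (x + e - y) * ψ y := by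
  rw [← (Equiv.addRight e).tsum_eq fun y => κ (x + e - y) * ψ y]
  simp only [Equiv.coe_addRight, add_sub_add_right_eq_sub]

theorem finite_support_latticeAdj {ψ : (Fin d → ℤ) → ℂ} (hψ : ψ.support.Finite) :
    (latticeAdj ψ).support.Finite := by
  refine (Set.finite_iUnion fun j : Fin d => (finite_support_comp_add hψ (Pi.single j 1)).union
    (finite_support_comp_add hψ (-Pi.single j 1))).subset fun x hx => ?_
  obtain ⟨j, -, hj⟩ := Finset.exists_ne_zero_of_sum_ne_zero (Function.mem_support.1 hx)
  refine Set.mem_iUnion.2 ⟨j, ?_⟩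
  by_contra h
  simp only [Set.mem_union, Function.mem_support, not_or, not_not, ← sub_eq_add_neg] at h
  exact hj (by rw [h.1, h.2, add_zero])

theorem tsum_mul_latticeAdj {ψ : (Fin d → ℤ) → ℂ} (hψ : ψ.support.Finite) (κ : (Fin d → ℤ) → ℂ)
    (x : Fin d → ℤ) :
    ∑' y, κ (x - y) * latticeAdj ψ y = ∑' y, latticeAdj κ (x - y) * ψ y := by
  have hs : ∀ (κ : (Fin d → ℤ) → ℂ) (e : Fin d → ℤ), Summable fun y => κ y * ψ (y + e) :=
    fun κ e => summable_mul_of_finite_support (finite_support_comp_add hψ e) κ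
  have hs' : ∀ κ : (Fin d → ℤ) → ℂ, Summable fun y => κ y * ψ y :=
    fun κ => summable_mul_of_finite_support hψ κ
  simp only [latticeAdj, Finset.mul_sum, Finset.sum_mul, mul_add, add_mul, sub_eq_add_neg _
    (Pi.single _ _)]
  rw [Summable.tsum_finsetSum fun j _ => (hs _ _).add (hs _ _),
    Summable.tsum_finsetSum fun j _ => (hs' _).add (hs' _)]
  refine Finset.sum_congr rfl fun j _ => ?_
  rw [(hs _ _).tsum_add (hs _ _), (hs' _).tsum_add (hs' _), tsum_sub_mul_comp_add,
    tsum_sub_mul_comp_add]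
  simp only [add_sub_right_comm, ← sub_eq_add_neg,
    sub_right_comm x (Pi.single j 1 : Fin d → ℤ)]

end latticeAdj

section propagator

/-- The symbol of the propagator `exp (i s (A - z))`. -/
def propSymbol {d : ℕ} (z : ℂ) (s : ℝ) (ξ : Fin d → ℝ) : ℂ :=
  Complex.exp (s * (Complex.I * (adjSymbol ξ - z)))

variable {d : ℕ} {z : ℂ}

@[fun_prop]
theorem continuous_uncurry_propSymbol :
    Continuous fun q : ℝ × (Fin d → ℝ) => propSymbol z q.1 q.2 := by
  unfold propSymbol
  fun_prop

@[fun_prop]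
theorem continuous_propSymbol (s : ℝ) : Continuous (propSymbol (d := d) z s) := by
  unfold propSymbol
  fun_prop

theorem norm_propSymbol_le_one (hz : z.im ≤ 0) {s : ℝ} (hs : 0 ≤ s) (ξ : Fin d → ℝ) :
    ‖propSymbol z s ξ‖ ≤ 1 := by
  rw [propSymbol, Complex.norm_exp, Real.exp_le_one_iff, Complex.re_ofReal_mul]
  simp only [Complex.mul_re, Complex.I_re, Complex.I_im, Complex.sub_im,
    Complex.ofReal_im]
  nlinarith

theorem norm_cubeCoeff_propSymbol_le (hz : z.im ≤ 0) {s : ℝ} (hs : 0 ≤ s) (x : Fin d → ℤ) :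
    ‖cubeCoeff (propSymbol z s) x‖ ≤ ‖∏ j, latticeBessel s (x j)‖ := by
  have h : propSymbol (d := d) z s = fun ξ => Complex.exp (-(s * (Complex.I * z))) *
      ∏ j, Complex.exp (Complex.I * ((2 * s * Real.cos (ξ j) : ℝ) : ℂ)) := by
    ext ξ
    rw [propSymbol, ← Complex.exp_sum, ← Complex.exp_add, adjSymbol]
    congr 1
    push_cast
    simp only [Finset.mul_sum, mul_sub]
    rw [sub_eq_neg_add]
    congr 1
    exact Finset.sum_congr rfl fun j _ => by ring
  rw [h, cubeCoeff_const_mul, cubeCoeff_prod (fun _ t =>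
    Complex.exp (Complex.I * ((2 * s * Real.cos t : ℝ) : ℂ))), norm_mul]
  have h1 : ‖Complex.exp (-(s * (Complex.I * z)))‖ ≤ 1 := by
    rw [Complex.norm_exp, Real.exp_le_one_iff, Complex.neg_re, Complex.re_ofReal_mul]
    simp only [Complex.mul_re, Complex.I_re, Complex.I_im]
    nlinarith
  refine (mul_le_of_le_one_left (norm_nonneg _) h1).trans (le_of_eq ?_)
  simp only [latticeBessel, ← Complex.exp_add, ← mul_add, ← Complex.ofReal_add]

/-- The symbol of the propagator integrated over the time interval `[a, b]`. -/
def timeSymbol {d : ℕ} (z : ℂ) (a b : ℝ) (ξ : Fin d → ℝ) : ℂ := ∫ s in a..b, propSymbol z s ξ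

theorem continuous_timeSymbol (a b : ℝ) : Continuous (timeSymbol (d := d) z a b) := by
  refine intervalIntegral.continuous_parametric_intervalIntegral_of_continuous' ?_ _ _
  have : Continuous fun q : (Fin d → ℝ) × ℝ => propSymbol z q.2 q.1 :=
    (continuous_uncurry_propSymbol (z := z)).comp continuous_swap
  exact this

theorem norm_timeSymbol_le (hz : z.im ≤ 0) {a b : ℝ} (ha : 0 ≤ a) (hab : a ≤ b)
    (ξ : Fin d → ℝ) : ‖timeSymbol z a b ξ‖ ≤ b - a := by
  refine (intervalIntegral.norm_integral_le_of_norm_le_const (C := 1) fun s hs => ?_).trans ?_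
  · rw [Set.uIoc_of_le hab] at hs
    exact norm_propSymbol_le_one hz (ha.trans hs.1.le) ξ
  · rw [one_mul, abs_of_nonneg (sub_nonneg.2 hab)]

theorem mul_timeSymbol (a b : ℝ) (ξ : Fin d → ℝ) :
    (adjSymbol ξ - z) * timeSymbol z a b ξ =
      -Complex.I * (propSymbol z b ξ - propSymbol z a ξ) := by
  have h : ∀ s : ℝ, HasDerivAt (fun s : ℝ => propSymbol z s ξ)
      (Complex.I * (adjSymbol ξ - z) * propSymbol z s ξ) s := fun s => by
    have h1 := ((Complex.ofRealCLM.hasDerivAt (x := s)).mul_const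
      (Complex.I * (adjSymbol ξ - z))).cexp
    simpa [propSymbol, mul_comm] using h1
  have h2 := intervalIntegral.integral_eq_sub_of_hasDerivAt (a := a) (b := b) (fun s _ => h s)
    (Continuous.intervalIntegrable (by unfold propSymbol; fun_prop) _ _)
  rw [intervalIntegral.integral_const_mul] at h2
  rw [← h2, timeSymbol, ← mul_assoc, ← mul_assoc, neg_mul, Complex.I_mul_I, neg_neg, one_mul]

theorem norm_cubeCoeff_timeSymbol_le (hz : z.im ≤ 0) {a b : ℝ} (ha : 0 ≤ a) (hab : a ≤ b)
    (x : Fin d → ℤ) :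
    ‖cubeCoeff (timeSymbol z a b) x‖ ≤ ∫ s in a..b, ‖∏ j, latticeBessel s (x j)‖ := by
  have hcb := fun j => continuous_latticeBessel (x j)
  have h := cubeCoeff_intervalIntegral hab (continuous_uncurry_propSymbol (z := z)) x
  rw [show timeSymbol z a b = fun ξ => ∫ s in a..b, propSymbol z s ξ from rfl, h]
  refine intervalIntegral.norm_integral_le_of_norm_le hab
    (ae_of_all _ fun s hs => norm_cubeCoeff_propSymbol_le hz (ha.trans hs.1.le) x) ?_
  exact Continuous.intervalIntegrable (by fun_prop) _ _

theorem tsum_cubeCoeff_timeSymbol_mul {ψ : (Fin d → ℤ) → ℂ} (hψ : ψ.support.Finite) (a b : ℝ)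
    (x : Fin d → ℤ) :
    ∑' y, cubeCoeff (timeSymbol z a b) (x - y) * (latticeAdj ψ y - z * ψ y) =
      -Complex.I * (∑' y, cubeCoeff (propSymbol z b) (x - y) * ψ y -
        ∑' y, cubeCoeff (propSymbol z a) (x - y) * ψ y) := by
  have hs : ∀ κ : (Fin d → ℤ) → ℂ, Summable fun y => κ y * ψ y :=
    fun κ => summable_mul_of_finite_support hψ κ
  have hsA : ∀ κ : (Fin d → ℤ) → ℂ, Summable fun y => κ y * latticeAdj ψ y :=
    fun κ => summable_mul_of_finite_support (finite_support_latticeAdj hψ) κ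
  have hc := continuous_timeSymbol (d := d) (z := z) a b
  set κ := cubeCoeff (timeSymbol (d := d) z a b) with hκ
  have hid : ∀ w, latticeAdj κ w - z * κ w =
      -Complex.I * (cubeCoeff (propSymbol z b) w - cubeCoeff (propSymbol z a) w) := by
    intro w
    rw [hκ, ← cubeCoeff_adjSymbol_mul hc, ← cubeCoeff_const_mul,
      ← cubeCoeff_sub (by fun_prop) (by fun_prop), ← cubeCoeff_sub (by fun_prop) (by fun_prop),
      ← cubeCoeff_const_mul]
    simp only [← sub_mul, mul_timeSymbol]
  have e1 : ∀ y, κ (x - y) * (latticeAdj ψ y - z * ψ y) =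
      κ (x - y) * latticeAdj ψ y - z * κ (x - y) * ψ y := fun y => by ring
  simp only [e1]
  rw [(hsA _).tsum_sub (hs _), tsum_mul_latticeAdj hψ, ← (hs _).tsum_sub (hs _),
    ← (hs _).tsum_sub (hs _), ← tsum_mul_left]
  refine tsum_congr fun y => ?_
  rw [← sub_mul, hid]
  ring

end propagator

section laplacian

variable {z : ℂ} {p : ℝ}

theorem finLp_timeStep_le {d : ℕ} (hz : z.im ≤ 0) {a b B D : ℝ} (ha : 0 ≤ a) (hab : a ≤ b)
    (hB : ∀ x : Fin d → ℤ, ∫ s in a..b, ‖∏ j, latticeBessel s (x j)‖ ≤ B) (hD0 : 0 ≤ D)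
    (hD : (b - a) ^ 2 * B ^ 4 ≤ D ^ 6) (hp0 : 0 < p) (hp : p < 6 / 5)
    (S F : Finset (Fin d → ℤ)) (g : (Fin d → ℤ) → ℂ) :
    finLp 6 F (fun x => ∑ y ∈ S, cubeCoeff (timeSymbol z a b) (x - y) * g y) ≤
      D * (interpConst p * finLp p S g) :=
  finLp_six_convolution_le (fun x => (norm_cubeCoeff_timeSymbol_le hz ha hab x).trans (hB x))
    (fun S F g => sum_norm_sq_multiplier_le (continuous_timeSymbol a b)
      (norm_timeSymbol_le hz ha hab) S F g) hD0 hD hp0 hp S F g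

theorem integral_norm_prod_latticeBessel_le_one (x : Fin 4 → ℤ) :
    ∫ s in (0:ℝ)..1, ‖∏ j, latticeBessel s (x j)‖ ≤ 1 := by
  have h := intervalIntegral.norm_integral_le_of_norm_le_const (a := 0) (b := 1) (C := 1)
    (f := fun s => ‖∏ j, latticeBessel s (x j)‖) fun s _ => by
      rw [norm_norm, norm_prod]
      exact Finset.prod_le_one (fun _ _ => norm_nonneg _) fun j _ => norm_latticeBessel_le_one s _
  exact (le_abs_self _).trans (by simpa using h)

theorem finLp_six_le_card_mul {G : Type*} {F : Finset G} {u : G → ℂ} {ε : ℝ} (hε : 0 ≤ ε)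
    (h : ∀ x, ‖u x‖ ≤ ε) : finLp 6 F u ≤ F.card * ε := by
  refine finLp_le_of_sum_le (n := 6) (by norm_num) (by positivity) ?_
  calc ∑ x ∈ F, ‖u x‖ ^ 6 ≤ ∑ x ∈ F, ε ^ 6 := Finset.sum_le_sum fun x _ => by
        have := h x
        gcongr
    _ = F.card * ε ^ 6 := by rw [Finset.sum_const, nsmul_eq_mul]
    _ ≤ (F.card * ε) ^ 6 := by
        rw [mul_pow]
        gcongr
        exact_mod_cast Nat.le_self_pow (by norm_num) _

theorem finLp_latticeAdj_sub_le_of_im_nonpos (hz : z.im ≤ 0) (hp0 : 0 < p) (hp : p < 6 / 5)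
    {ψ : (Fin 4 → ℤ) → ℂ} (hψ : ψ.support.Finite) {S : Finset (Fin 4 → ℤ)}
    (hS : ∀ x ∉ S, latticeAdj ψ x - z * ψ x = 0) (F : Finset (Fin 4 → ℤ)) :
    finLp 6 F ψ ≤ (5 * 10 ^ 5 + 1) * interpConst p *
      finLp p S (fun x => latticeAdj ψ x - z * ψ x) := by
  set g := fun x => latticeAdj ψ x - z * ψ x with hg
  set U : ℝ → (Fin 4 → ℤ) → ℂ := fun s x => ∑' y, cubeCoeff (propSymbol z s) (x - y) * ψ y with hU
  set T : ℝ → ℝ → (Fin 4 → ℤ) → ℂ :=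
    fun a b x => ∑ y ∈ S, cubeCoeff (timeSymbol z a b) (x - y) * g y with hT
  set X := interpConst p * finLp p S g with hX
  have hX0 : 0 ≤ X := mul_nonneg (interpConst_pos hp).le (finLp_nonneg _ _ _)
  have hUT : ∀ a b x, U a x = U b x + -Complex.I * T a b x := by
    intro a b x
    have h := tsum_cubeCoeff_timeSymbol_mul (z := z) hψ a b x
    rw [tsum_eq_sum (s := S) fun y hy => by rw [hS y hy, mul_zero]] at h
    have h' : T a b x = -Complex.I * (U b x - U a x) := h
    rw [h']
    linear_combination (-(U b x - U a x)) * Complex.I_mul_I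
  have hU0 : ∀ x, U 0 x = ψ x := by
    intro x
    have h0 : propSymbol (d := 4) z 0 = fun _ => 1 := by
      ext ξ
      simp [propSymbol]
    simp only [hU, h0]
    rw [tsum_eq_single x]
    · rw [cubeCoeff_one, if_pos (sub_self x), one_mul]
    · intro y hy
      rw [cubeCoeff_one, if_neg (sub_ne_zero.2 hy.symm), zero_mul]
  have htel : ∀ K : ℕ, ∀ x, ψ x = U (8 ^ K) x + (-Complex.I * T 0 1 x +
      ∑ k ∈ Finset.range K, -Complex.I * T (8 ^ k) (8 ^ (k + 1)) x) := by
    intro K x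
    induction K with
    | zero => rw [← hU0, hUT 0 1]; simp
    | succ K ih =>
      rw [Finset.sum_range_succ]
      rw [hUT (8 ^ K) (8 ^ (K + 1))] at ih
      rw [ih]
      ring
  have hmulI : ∀ u : (Fin 4 → ℤ) → ℂ, finLp 6 F (fun x => -Complex.I * u x) = finLp 6 F u :=
    fun u => by simp [finLp]
  have hinit : finLp 6 F (T 0 1) ≤ 1 * X :=
    finLp_timeStep_le hz le_rfl zero_le_one integral_norm_prod_latticeBessel_le_one zero_le_one
      (by norm_num) hp0 hp S F g
  have hstep : ∀ k : ℕ, finLp 6 F (T (8 ^ k) (8 ^ (k + 1))) ≤ (10 ^ 5 * (4 / 5) ^ k) * X := by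
    intro k
    have h83 : ((2:ℝ) ^ k) ^ 3 = 8 ^ k := by rw [← pow_mul, mul_comm, pow_mul]; norm_num
    have hab : (8:ℝ) ^ k ≤ 8 ^ (k + 1) := pow_le_pow_right₀ (by norm_num) k.le_succ
    refine finLp_timeStep_le hz (by positivity) hab (fun x =>
      integral_norm_prod_latticeBessel_le (r := 2 ^ k) (one_le_pow₀ one_le_two) h83.le hab x)
      (by positivity) ?_ hp0 hp S F g
    have e : ((2:ℝ) ^ k) ^ 2 = 4 ^ k := by rw [← pow_mul, mul_comm, pow_mul]; norm_num
    calc ((8:ℝ) ^ (k + 1) - 8 ^ k) ^ 2 * (2 * 10 ^ 6 / (2 ^ k) ^ 2) ^ 4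
        = 49 * 16 * 10 ^ 24 * (1 / 4) ^ k := by
          have e2 : ((8:ℝ) ^ k) ^ 2 = 64 ^ k := by rw [← pow_mul, mul_comm, pow_mul]; norm_num
          have e3 : ((4:ℝ) ^ k) ^ 4 = 256 ^ k := by rw [← pow_mul, mul_comm, pow_mul]; norm_num
          have e4 : (64:ℝ) ^ k = 256 ^ k * (1 / 4) ^ k := by rw [← mul_pow]; norm_num
          rw [e, div_pow, e3, show ((8:ℝ) ^ (k + 1) - 8 ^ k) ^ 2 = 49 * (8 ^ k) ^ 2 by ring, e2, e4]
          field_simp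
          norm_num
      _ ≤ 10 ^ 30 * ((4 / 5) ^ 6) ^ k := by
          gcongr <;> norm_num
      _ = (10 ^ 5 * (4 / 5) ^ k) ^ 6 := by
          rw [mul_pow, ← pow_mul, ← pow_mul, ← pow_mul, mul_comm 6 k]
  set W := ∑ y ∈ hψ.toFinset, ‖ψ y‖ with hW
  have hW0 : 0 ≤ W := Finset.sum_nonneg fun _ _ => norm_nonneg _
  have hdecay : ∀ K : ℕ, finLp 6 F (U (8 ^ K)) ≤ F.card * (10 ^ 6 * (1 / 16) ^ K * W) := by
    intro K
    refine finLp_six_le_card_mul (by positivity) fun x => ?_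
    have hs : U (8 ^ K) x =
        ∑ y ∈ hψ.toFinset, cubeCoeff (propSymbol z (8 ^ K)) (x - y) * ψ y :=
      tsum_eq_sum fun y hy => by
        rw [Function.notMem_support.1 fun h => hy (hψ.mem_toFinset.2 h), mul_zero]
    rw [hs, hW, Finset.mul_sum]
    refine (norm_sum_le _ _).trans (Finset.sum_le_sum fun y _ => ?_)
    rw [norm_mul]
    refine mul_le_mul_of_nonneg_right ?_ (norm_nonneg _)
    refine (norm_cubeCoeff_propSymbol_le hz (by positivity) _).trans ?_
    have h83 : ((2:ℝ) ^ K) ^ 3 = 8 ^ K := by rw [← pow_mul, mul_comm, pow_mul]; norm_num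
    refine (norm_prod_latticeBessel_le (r := 2 ^ K) (one_le_pow₀ one_le_two) h83.le _).trans
      (le_of_eq ?_)
    rw [one_div, inv_pow, ← div_eq_mul_inv, ← pow_mul, mul_comm K, pow_mul]
    norm_num
  have hK : ∀ K : ℕ, finLp 6 F ψ ≤
      F.card * (10 ^ 6 * (1 / 16) ^ K * W) + (5 * 10 ^ 5 + 1) * X := by
    intro K
    have h1 : finLp 6 F ψ = finLp 6 F (fun x => U (8 ^ K) x + (-Complex.I * T 0 1 x +
        ∑ k ∈ Finset.range K, -Complex.I * T (8 ^ k) (8 ^ (k + 1)) x)) := by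
      congr 1
      exact funext (htel K)
    have h6 : (1:ℝ) ≤ 6 := by norm_num
    have hgeo : ∑ k ∈ Finset.range K, ((4:ℝ) / 5) ^ k ≤ 5 := by
      have h0 : (0:ℝ) ≤ 4 / 5 := by norm_num
      have h1 : (4:ℝ) / 5 < 1 := by norm_num
      have := (summable_geometric_of_lt_one h0 h1).sum_le_tsum (Finset.range K)
        fun _ _ => by positivity
      rw [tsum_geometric_of_lt_one h0 h1] at this
      exact this.trans (by norm_num)
    rw [h1]
    calc _ ≤ finLp 6 F (U (8 ^ K)) + (finLp 6 F (T 0 1) +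
          ∑ k ∈ Finset.range K, finLp 6 F (T (8 ^ k) (8 ^ (k + 1)))) := by
          refine (finLp_add_le h6 F _ _).trans (add_le_add_right
            ((finLp_add_le h6 F _ _).trans ?_) _)
          rw [hmulI]
          refine add_le_add_right ((finLp_sum_le h6 F _ _).trans (le_of_eq ?_)) _
          simp only [hmulI]
      _ ≤ F.card * (10 ^ 6 * (1 / 16) ^ K * W) + (1 * X +
          ∑ k ∈ Finset.range K, (10 ^ 5 * (4 / 5) ^ k) * X) := by
          gcongr with k
          · exact hdecay K
          · exact hstep k
      _ = F.card * (10 ^ 6 * (1 / 16) ^ K * W) +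
          (10 ^ 5 * ∑ k ∈ Finset.range K, (4 / 5) ^ k + 1) * X := by
          rw [← Finset.sum_mul, ← Finset.mul_sum]
          ring
      _ ≤ _ := by
          rw [mul_comm 5]
          gcongr
  have hlim : Filter.Tendsto (fun K : ℕ => F.card * (10 ^ 6 * (1 / 16 : ℝ) ^ K * W) +
      (5 * 10 ^ 5 + 1) * X) Filter.atTop (nhds (F.card * (10 ^ 6 * 0 * W) +
      (5 * 10 ^ 5 + 1) * X)) :=
    ((((tendsto_pow_atTop_nhds_zero_of_lt_one (by norm_num) (by norm_num)).const_mul _).mul_const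
      _).const_mul _).add_const _
  have := ge_of_tendsto' hlim hK
  rw [hX] at this
  linarith

/-- The uniform resolvent estimate for the lattice Laplacian, on finitely supported functions. -/
theorem finLp_latticeAdj_sub_le (z : ℂ) (hp0 : 0 < p) (hp : p < 6 / 5)
    {ψ : (Fin 4 → ℤ) → ℂ} (hψ : ψ.support.Finite) {S : Finset (Fin 4 → ℤ)}
    (hS : ∀ x ∉ S, latticeAdj ψ x - z * ψ x = 0) (F : Finset (Fin 4 → ℤ)) :
    finLp 6 F ψ ≤ (5 * 10 ^ 5 + 1) * interpConst p *
      finLp p S (fun x => latticeAdj ψ x - z * ψ x) := by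
  rcases le_total z.im 0 with hz | hz
  · exact finLp_latticeAdj_sub_le_of_im_nonpos hz hp0 hp hψ hS F
  set φ : (Fin 4 → ℤ) → ℂ := fun x => (starRingEnd ℂ) (ψ x) with hφ
  have hφg : ∀ x, latticeAdj φ x - (starRingEnd ℂ) z * φ x =
      (starRingEnd ℂ) (latticeAdj ψ x - z * ψ x) := fun x => by
    simp only [latticeAdj, hφ, map_sub, map_mul, map_sum, map_add]
  have hφs : φ.support.Finite := by
    refine hψ.subset fun x hx h => hx ?_
    simp [hφ, h]
  have h := finLp_latticeAdj_sub_le_of_im_nonpos (z := (starRingEnd ℂ) z) (S := S)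
    (by simpa using hz) hp0 hp hφs (fun x hx => by rw [hφg, hS x hx, map_zero]) F
  simpa only [hφg, finLp, Complex.norm_conj, show ∀ x, ‖φ x‖ = ‖ψ x‖ from
    fun x => Complex.norm_conj _] using h

end laplacian

section sqrtSeries

/-- The Taylor coefficients of `t ↦ √(9 - t)` at the origin. -/
def sqrtCoeff (k : ℕ) : ℝ := 3 * Ring.choose (1 / 2 : ℝ) k * (-1 / 9) ^ k

theorem hasSum_sqrtCoeff_mul_pow {t : ℝ} (ht : |t| ≤ 8) :
    HasSum (fun k => sqrtCoeff k * t ^ k) √(9 - t) := by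
  have hmem : -t / 9 ∈ Metric.eball (0 : ℝ) 1 := by
    rw [mem_eball_zero_iff, enorm_eq_nnnorm, ← ENNReal.coe_one, ENNReal.coe_lt_coe,
      ← NNReal.coe_lt_coe, coe_nnnorm, Real.norm_eq_abs, NNReal.coe_one, abs_div, abs_neg,
      abs_of_pos (by norm_num : (0 : ℝ) < 9)]
    linarith
  have h := (Real.one_add_rpow_hasFPowerSeriesOnBall_zero (a := 1 / 2)).hasSum hmem
  have h' := h.mul_left 3
  rw [zero_add, ← Real.sqrt_eq_rpow] at h'
  convert! h' using 1
  · ext k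
    rw [binomialSeries_apply, List.ofFn_const, List.prod_replicate, smul_eq_mul, sqrtCoeff,
      mul_assoc, mul_assoc, ← mul_pow]
    congr 3
    ring
  · rw [show (9 - t : ℝ) = 3 ^ 2 * (1 + -t / 9) by ring, Real.sqrt_mul (by norm_num),
      Real.sqrt_sq (by norm_num)]

theorem summable_abs_sqrtCoeff_mul_pow : Summable fun k => |sqrtCoeff k| * 8 ^ k := by
  have hr : ((8 / 9 : NNReal) : ℝ≥0∞) < (binomialSeries ℝ (1 / 2 : ℝ)).radius := by
    refine lt_of_lt_of_le ?_ binomialSeries_radius_ge_one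
    rw [← ENNReal.coe_one, ENNReal.coe_lt_coe, ← NNReal.coe_lt_coe]
    norm_num
  refine (((binomialSeries ℝ (1 / 2 : ℝ)).summable_norm_mul_pow hr).mul_left 3).congr fun k => ?_
  rw [binomialSeries, FormalMultilinearSeries.ofScalars_norm, sqrtCoeff, abs_mul, abs_mul, abs_pow,
    Real.norm_eq_abs, mul_assoc _ (_ ^ k), ← mul_pow, abs_of_pos (by norm_num : (0 : ℝ) < 3),
    ← mul_assoc]
  norm_num

end sqrtSeries

section sqrtOneSubLap

variable {d : ℕ}

theorem abs_adjSymbol_le (ξ : Fin d → ℝ) : |adjSymbol ξ| ≤ 2 * d := by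
  refine (Finset.abs_sum_le_sum_abs _ _).trans ?_
  refine (Finset.sum_le_card_nsmul _ _ 2 fun j _ => ?_).trans (by simp [mul_comm])
  rw [abs_mul, abs_two]
  linarith [Real.abs_cos_le_one (ξ j)]

theorem omegaKG_eq_sqrt (ξ : Fin 4 → ℝ) : omegaKG 4 ξ = √(9 - adjSymbol ξ) := by
  rw [omegaKG, adjSymbol]
  congr 1
  simp only [Fin.sum_univ_four]
  ring

@[fun_prop]
theorem continuous_omegaKG : Continuous (omegaKG d) := by
  unfold omegaKG
  fun_prop

/-- The kernel of the `k`-th power of the adjacency operator of `ℤ^d`. -/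
def adjPowKernel {d : ℕ} (k : ℕ) : (Fin d → ℤ) → ℂ := cubeCoeff fun ξ => (adjSymbol ξ : ℂ) ^ k

theorem adjPowKernel_zero (x : Fin d → ℤ) : adjPowKernel 0 x = if x = 0 then 1 else 0 := by
  simp only [adjPowKernel, pow_zero, cubeCoeff_one]

theorem adjPowKernel_succ (k : ℕ) (x : Fin d → ℤ) :
    adjPowKernel (k + 1) x = latticeAdj (adjPowKernel k) x := by
  simp only [adjPowKernel, pow_succ']
  exact cubeCoeff_adjSymbol_mul (by fun_prop) x

theorem hasSum_latticeAdj {u : (Fin d → ℤ) → ℝ} {s : ℝ} (hu : HasSum u s) :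
    HasSum (fun x : Fin d → ℤ => ∑ j : Fin d, (u (x + Pi.single j 1) + u (x - Pi.single j 1)))
      (2 * d * s) := by
  have h : ∀ j : Fin d, HasSum (fun x : Fin d → ℤ => u (x + Pi.single j 1) + u (x - Pi.single j 1)) (s + s) :=
    fun j => ((Equiv.addRight (Pi.single j 1)).hasSum_iff.2 hu).add
      ((Equiv.subRight (Pi.single j 1)).hasSum_iff.2 hu)
  convert! hasSum_sum fun j (_ : j ∈ Finset.univ) => h j using 1
  simp
  ring

theorem norm_latticeAdj_le (u : (Fin d → ℤ) → ℂ) (x : Fin d → ℤ) :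
    ‖latticeAdj u x‖ ≤ ∑ j : Fin d, (‖u (x + Pi.single j 1)‖ + ‖u (x - Pi.single j 1)‖) :=
  (norm_sum_le _ _).trans (Finset.sum_le_sum fun _ _ => norm_add_le _ _)

theorem summable_norm_adjPowKernel (k : ℕ) :
    Summable (fun x : Fin d → ℤ => ‖adjPowKernel k x‖) ∧
      ∑' x : Fin d → ℤ, ‖adjPowKernel k x‖ ≤ (2 * d) ^ k := by
  induction k with
  | zero =>
    have h : HasSum (fun x : Fin d → ℤ => ‖adjPowKernel 0 x‖) 1 := by
      convert! hasSum_ite_eq (0 : Fin d → ℤ) (1 : ℝ) using 1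
      ext x
      rw [adjPowKernel_zero]
      split_ifs <;> simp
    exact ⟨h.summable, by rw [h.tsum_eq, pow_zero]⟩
  | succ k ih =>
    have h := hasSum_latticeAdj ih.1.hasSum
    have hle : ∀ x : Fin d → ℤ, ‖adjPowKernel (k + 1) x‖ ≤ _ := fun x =>
      (congrArg norm (adjPowKernel_succ k x)).trans_le (norm_latticeAdj_le _ x)
    have hs : Summable fun x : Fin d → ℤ => ‖adjPowKernel (k + 1) x‖ :=
      h.summable.of_nonneg_of_le (fun _ => norm_nonneg _) hle
    refine ⟨hs, (hs.tsum_le_tsum hle h.summable).trans ?_⟩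
    rw [h.tsum_eq, pow_succ']
    exact mul_le_mul_of_nonneg_left ih.2 (by positivity)

theorem hasSum_adjPowKernel_mul {m : (Fin d → ℝ) → ℂ} (hm : Continuous m) (k : ℕ)
    (x : Fin d → ℤ) :
    HasSum (fun y => adjPowKernel k (x - y) * cubeCoeff m y)
      (cubeCoeff (fun ξ => (adjSymbol ξ : ℂ) ^ k * m ξ) x) := by
  induction k generalizing x with
  | zero =>
    simp only [pow_zero, one_mul]
    convert! hasSum_ite_eq x (cubeCoeff m x) using 1
    ext y
    rw [adjPowKernel_zero]
    by_cases h : x = y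
    · simp [h]
    · simp [h, sub_eq_zero, Ne.symm h]
  | succ k ih =>
    simp only [pow_succ', mul_assoc]
    rw [cubeCoeff_adjSymbol_mul (m := fun ξ => (adjSymbol ξ : ℂ) ^ k * m ξ) (by fun_prop)]
    convert! hasSum_sum fun j (_ : j ∈ Finset.univ) =>
      (ih (x + Pi.single j 1)).add (ih (x - Pi.single j 1)) using 1
    ext y
    simp only [adjPowKernel_succ, latticeAdj, Finset.sum_mul, add_mul, add_sub_right_comm,
      sub_right_comm x (Pi.single _ 1 : Fin d → ℤ)]

theorem hasSum_cubeCoeff_sqrt {m : (Fin 4 → ℝ) → ℂ} (hm : Continuous m) (x : Fin 4 → ℤ) :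
    HasSum (fun k => (sqrtCoeff k : ℂ) * cubeCoeff (fun ξ => (adjSymbol ξ : ℂ) ^ k * m ξ) x)
      (cubeCoeff (fun ξ => (omegaKG 4 ξ : ℂ) * m ξ) x) := by
  have hb : ∀ ξ : Fin 4 → ℝ, |adjSymbol ξ| ≤ 8 := fun ξ =>
    (abs_adjSymbol_le ξ).trans_eq (by norm_num)
  set G : ℕ → (Fin 4 → ℝ) → ℂ := fun k ξ =>
    latticeChar x ξ * ((sqrtCoeff k : ℂ) * ((adjSymbol ξ : ℂ) ^ k * m ξ)) with hG
  have hGi : ∀ k, Integrable (G k) (volume.restrict (cube 4)) := fun k =>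
    integrableOn_latticeChar_mul (m := fun ξ => (sqrtCoeff k : ℂ) * ((adjSymbol ξ : ℂ) ^ k * m ξ))
      (by fun_prop) x
  have hmi : Integrable (fun ξ => ‖m ξ‖) (volume.restrict (cube 4)) := (integrableOn_cube hm).norm
  have hGs : Summable fun k => ∫ ξ in cube 4, ‖G k ξ‖ := by
    refine (summable_abs_sqrtCoeff_mul_pow.mul_right (∫ ξ in cube 4, ‖m ξ‖)).of_nonneg_of_le
      (fun k => integral_nonneg fun _ => norm_nonneg _) fun k => ?_
    rw [← integral_const_mul]
    refine integral_mono (hGi k).norm (hmi.const_mul _) fun ξ => ?_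
    simp only [hG, norm_mul, norm_latticeChar, one_mul, Complex.norm_real, Real.norm_eq_abs,
      norm_pow, ← mul_assoc]
    gcongr
    exact hb ξ
  have h := hasSum_integral_of_summable_integral_norm hGi hGs
  have hlim : ∀ ξ, ∑' k, G k ξ = latticeChar x ξ * ((omegaKG 4 ξ : ℂ) * m ξ) := fun ξ => by
    have := ((Complex.hasSum_ofReal.2 (hasSum_sqrtCoeff_mul_pow (hb ξ))).mul_right (m ξ)).mul_left
      (latticeChar x ξ)
    rw [omegaKG_eq_sqrt, ← this.tsum_eq]
    refine tsum_congr fun k => ?_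
    simp only [hG, Complex.ofReal_mul, Complex.ofReal_pow, mul_assoc]
  simp only [hlim] at h
  convert! h.mul_left ((((2 * π) ^ 4)⁻¹ : ℝ) : ℂ) using 1
  ext k
  rw [← cubeCoeff_const_mul, cubeCoeff]

theorem hasSum_sqrtCoeff_mul_adjPowKernel (x : Fin 4 → ℤ) :
    HasSum (fun k => (sqrtCoeff k : ℂ) * adjPowKernel k x) (multKernel 4 (omegaKG 4) x) := by
  have h := hasSum_cubeCoeff_sqrt (m := fun _ => 1) continuous_const x
  simp only [mul_one] at h
  exact h

theorem summable_sqrtCoeff_mul_adjPowKernel :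
    Summable fun q : ℕ × (Fin 4 → ℤ) => |sqrtCoeff q.1| * ‖adjPowKernel q.1 q.2‖ := by
  have h0 : ∀ q : ℕ × (Fin 4 → ℤ), 0 ≤ |sqrtCoeff q.1| * ‖adjPowKernel q.1 q.2‖ :=
    fun q => mul_nonneg (abs_nonneg _) (norm_nonneg _)
  have h1 : ∀ k, Summable fun x : Fin 4 → ℤ => |sqrtCoeff k| * ‖adjPowKernel k x‖ :=
    fun k => (summable_norm_adjPowKernel k).1.mul_left _
  have h2 : ∀ k, ∑' x : Fin 4 → ℤ, |sqrtCoeff k| * ‖adjPowKernel k x‖ ≤ |sqrtCoeff k| * 8 ^ k := by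
    intro k
    rw [tsum_mul_left]
    refine mul_le_mul_of_nonneg_left ((summable_norm_adjPowKernel k).2.trans_eq ?_) (abs_nonneg _)
    norm_num
  have h3 : ∀ k, 0 ≤ ∑' x : Fin 4 → ℤ, |sqrtCoeff k| * ‖adjPowKernel k x‖ :=
    fun k => tsum_nonneg fun x => h0 (k, x)
  have h4 : Summable fun k => ∑' x : Fin 4 → ℤ, |sqrtCoeff k| * ‖adjPowKernel k x‖ :=
    summable_abs_sqrtCoeff_mul_pow.of_nonneg_of_le h3 h2
  exact (summable_prod_of_nonneg h0).2 ⟨h1, h4⟩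

theorem summable_norm_multKernel_omegaKG :
    Summable fun x : Fin 4 → ℤ => ‖multKernel 4 (omegaKG 4) x‖ := by
  have h := summable_sqrtCoeff_mul_adjPowKernel.prod_symm
  refine h.prod.of_nonneg_of_le (fun _ => norm_nonneg _) fun x => ?_
  have hx : Summable fun k => ‖(sqrtCoeff k : ℂ) * adjPowKernel k x‖ := by
    simpa only [norm_mul, Complex.norm_real, Real.norm_eq_abs, Prod.fst_swap, Prod.snd_swap]
      using h.prod_factor x
  rw [← (hasSum_sqrtCoeff_mul_adjPowKernel x).tsum_eq]
  refine (norm_tsum_le_tsum_norm hx).trans_eq (tsum_congr fun k => ?_)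
  simp

theorem sqrtOneSubLap_cubeCoeff {m : (Fin 4 → ℝ) → ℂ} (hm : Continuous m) {B : ℝ}
    (hB : ∀ ξ, ‖m ξ‖ ≤ B) (x : Fin 4 → ℤ) :
    sqrtOneSubLap 4 (cubeCoeff m) x = cubeCoeff (fun ξ => (omegaKG 4 ξ : ℂ) * m ξ) x := by
  have hi : Function.Injective fun q : (Fin 4 → ℤ) × ℕ => (q.2, x - q.1) := fun q q' h => by
    simpa [Prod.ext_iff, and_comm] using h
  have h : Summable fun q : (Fin 4 → ℤ) × ℕ => |sqrtCoeff q.2| * ‖adjPowKernel q.2 (x - q.1)‖ := by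
    simpa only [Function.comp_def] using summable_sqrtCoeff_mul_adjPowKernel.comp_injective hi
  have hle : ∀ q : (Fin 4 → ℤ) × ℕ,
      ‖(sqrtCoeff q.2 : ℂ) * (adjPowKernel q.2 (x - q.1) * cubeCoeff m q.1)‖ ≤
        |sqrtCoeff q.2| * ‖adjPowKernel q.2 (x - q.1)‖ * B := fun q => by
    rw [norm_mul, norm_mul, Complex.norm_real, Real.norm_eq_abs, ← mul_assoc]
    exact mul_le_mul_of_nonneg_left (norm_cubeCoeff_le hB _)
      (mul_nonneg (abs_nonneg _) (norm_nonneg _))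
  have hs : Summable (Function.uncurry fun (y : Fin 4 → ℤ) (k : ℕ) =>
      (sqrtCoeff k : ℂ) * (adjPowKernel k (x - y) * cubeCoeff m y)) :=
    .of_norm_bounded (h.mul_right B) hle
  have hk : ∀ k, ∑' y, (sqrtCoeff k : ℂ) * (adjPowKernel k (x - y) * cubeCoeff m y) =
      (sqrtCoeff k : ℂ) * cubeCoeff (fun ξ => (adjSymbol ξ : ℂ) ^ k * m ξ) x := fun k => by
    rw [tsum_mul_left, (hasSum_adjPowKernel_mul hm k x).tsum_eq]
  have hy : ∀ y, ∑' k, (sqrtCoeff k : ℂ) * (adjPowKernel k (x - y) * cubeCoeff m y) =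
      multKernel 4 (omegaKG 4) (x - y) * cubeCoeff m y := fun y => by
    simp only [← mul_assoc]
    rw [tsum_mul_right, (hasSum_sqrtCoeff_mul_adjPowKernel (x - y)).tsum_eq]
  rw [← (hasSum_cubeCoeff_sqrt hm x).tsum_eq, sqrtOneSubLap]
  simp only [← hk, ← hy]
  exact hs.tsum_comm.symm

/-- `√(1 - Δ)` squares to `1 - Δ`. -/
theorem sqrtOneSubLap_sqrtOneSubLap {ψ : (Fin 4 → ℤ) → ℂ} (hψ : ψ.support.Finite)
    (x : Fin 4 → ℤ) :
    sqrtOneSubLap 4 (sqrtOneSubLap 4 ψ) x = 9 * ψ x - latticeAdj ψ x := by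
  set S := hψ.toFinset
  have hS : ∀ y ∉ S, ψ y = 0 := fun y hy => by simpa [S] using hy
  set P : (Fin 4 → ℝ) → ℂ := fun ξ => ∑ y ∈ S, ψ y * latticeChar (-y) ξ with hP
  have hPc : Continuous P := by fun_prop
  have hPψ : cubeCoeff P = ψ := by
    ext y
    have h := cubeCoeff_sum_latticeChar S ψ (m := fun _ => 1) continuous_const y
    simp only [mul_one, cubeCoeff_one, sub_eq_zero, ite_mul, one_mul, zero_mul,
      Finset.sum_ite_eq] at h
    rw [hP, h]
    split_ifs with hy
    · rfl
    · exact (hS y hy).symm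
  have hPb : ∀ ξ, ‖P ξ‖ ≤ ∑ y ∈ S, ‖ψ y‖ := fun ξ => (norm_sum_le _ _).trans_eq <|
    Finset.sum_congr rfl fun y _ => by rw [norm_mul, norm_latticeChar, mul_one]
  have hωb : ∀ ξ, ‖(omegaKG 4 ξ : ℂ)‖ ≤ 5 := fun ξ => by
    rw [Complex.norm_real, Real.norm_eq_abs, omegaKG_eq_sqrt, abs_of_nonneg (Real.sqrt_nonneg _)]
    refine Real.sqrt_le_iff.2 ⟨by norm_num, ?_⟩
    have := (abs_le.1 (abs_adjSymbol_le ξ)).1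
    norm_num at this ⊢
    linarith
  have h1 : sqrtOneSubLap 4 ψ = cubeCoeff fun ξ => (omegaKG 4 ξ : ℂ) * P ξ := by
    ext y
    rw [← sqrtOneSubLap_cubeCoeff hPc hPb, hPψ]
  have h2 : ∀ ξ, (omegaKG 4 ξ : ℂ) * ((omegaKG 4 ξ : ℂ) * P ξ) =
      9 * P ξ - (adjSymbol ξ : ℂ) * P ξ := fun ξ => by
    have h := (abs_le.1 (abs_adjSymbol_le ξ)).2
    rw [← mul_assoc, ← Complex.ofReal_mul, omegaKG_eq_sqrt, Real.mul_self_sqrt]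
    · push_cast
      ring
    · norm_num at h
      linarith
  rw [h1, sqrtOneSubLap_cubeCoeff (by fun_prop) (B := 5 * ∑ y ∈ S, ‖ψ y‖) fun ξ => by
    rw [norm_mul]
    exact mul_le_mul (hωb ξ) (hPb ξ) (norm_nonneg _) (by norm_num)]
  simp only [h2]
  rw [cubeCoeff_sub (m := fun ξ => 9 * P ξ) (n := fun ξ => (adjSymbol ξ : ℂ) * P ξ) (by fun_prop)
    (by fun_prop), cubeCoeff_const_mul, cubeCoeff_adjSymbol_mul hPc, hPψ]

end sqrtOneSubLap

section countingNorm

variable {G : Type*} {p q : ℝ}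

theorem ENNReal.tsum_mul_rpow_le (hp : 1 ≤ p) (w f : G → ℝ≥0∞) :
    (∑' y, w y * f y) ^ p ≤ (∑' y, w y) ^ (p - 1) * ∑' y, w y * f y ^ p := by
  have hp0 : 0 < p := zero_lt_one.trans_le hp
  have h : ∑' y, w y * f y ≤ (∑' y, w y) ^ (1 - p⁻¹) * (∑' y, w y * f y ^ p) ^ p⁻¹ := by
    refine ENNReal.summable.tsum_le_of_sum_le fun s => ?_
    refine (ENNReal.inner_le_weight_mul_Lp_of_nonneg s hp w f).trans ?_
    have h1 : 0 ≤ 1 - p⁻¹ := sub_nonneg.2 (inv_le_one_of_one_le₀ hp)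
    gcongr <;> exact ENNReal.sum_le_tsum s
  refine (ENNReal.rpow_le_rpow h hp0.le).trans_eq ?_
  rw [ENNReal.mul_rpow_of_nonneg _ _ hp0.le, ← ENNReal.rpow_mul, ← ENNReal.rpow_mul,
    inv_mul_cancel₀ hp0.ne', ENNReal.rpow_one, sub_mul, one_mul, inv_mul_cancel₀ hp0.ne']

theorem ENNReal.tsum_convolution_rpow_le [AddCommGroup G] (hp : 1 ≤ p) (w f : G → ℝ≥0∞) :
    ∑' x, (∑' y, w (x - y) * f y) ^ p ≤ (∑' y, w y) ^ p * ∑' y, f y ^ p := by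
  have hl : ∀ x, ∑' y, w (x - y) = ∑' y, w y := fun x => (Equiv.subLeft x).tsum_eq w
  have hr : ∀ y, ∑' x, w (x - y) = ∑' x, w x := fun y => (Equiv.subRight y).tsum_eq w
  calc ∑' x, (∑' y, w (x - y) * f y) ^ p
      ≤ ∑' x, (∑' y, w y) ^ (p - 1) * ∑' y, w (x - y) * f y ^ p :=
        ENNReal.tsum_le_tsum fun x => by
          simpa only [hl] using ENNReal.tsum_mul_rpow_le hp (fun y => w (x - y)) f
    _ = (∑' y, w y) ^ (p - 1) * ((∑' y, w y) * ∑' y, f y ^ p) := by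
        rw [ENNReal.tsum_mul_left, ENNReal.tsum_comm]
        simp only [ENNReal.tsum_mul_right, hr, ENNReal.tsum_mul_left]
    _ = _ := by
        rw [← mul_assoc]
        nth_rw 2 [← ENNReal.rpow_one (∑' y, w y)]
        rw [← ENNReal.rpow_add_of_nonneg _ _ (sub_nonneg.2 hp) zero_le_one, sub_add_cancel]

theorem ofReal_finLp (hp : 0 < p) (F : Finset G) (u : G → ℂ) :
    ENNReal.ofReal (finLp p F u) = (∑ x ∈ F, ‖u x‖ₑ ^ p) ^ (1 / p) := by
  rw [finLp, ← ENNReal.ofReal_rpow_of_nonneg (by positivity) (by positivity),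
    ENNReal.ofReal_sum_of_nonneg fun _ _ => by positivity]
  congr 1
  refine Finset.sum_congr rfl fun x _ => ?_
  rw [← ENNReal.ofReal_rpow_of_nonneg (norm_nonneg _) hp.le, ofReal_norm]

variable [MeasurableSpace G] [MeasurableSingletonClass G]

theorem eLpNorm_count_eq_tsum (hp : 0 < p) (u : G → ℂ) :
    eLpNorm u (ENNReal.ofReal p) Measure.count = (∑' x, ‖u x‖ₑ ^ p) ^ (1 / p) := by
  rw [eLpNorm_eq_lintegral_rpow_enorm_toReal (by simpa using hp) ENNReal.ofReal_ne_top,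
    lintegral_count, ENNReal.toReal_ofReal hp.le]

theorem eLpNorm_count_rpow (hp : 0 < p) (u : G → ℂ) :
    eLpNorm u (ENNReal.ofReal p) Measure.count ^ p = ∑' x, ‖u x‖ₑ ^ p := by
  rw [eLpNorm_count_eq_tsum hp, ← ENNReal.rpow_mul, one_div_mul_cancel hp.ne', ENNReal.rpow_one]

theorem eLpNorm_count_anti (hp : 0 < p) (hpq : p ≤ q) (u : G → ℂ) :
    eLpNorm u (ENNReal.ofReal q) Measure.count ≤ eLpNorm u (ENNReal.ofReal p) Measure.count := by
  have hq : 0 < q := hp.trans_le hpq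
  set N := eLpNorm u (ENNReal.ofReal p) Measure.count with hN
  rw [← ENNReal.rpow_le_rpow_iff hq, eLpNorm_count_rpow hq]
  calc ∑' x, ‖u x‖ₑ ^ q ≤ ∑' x, N ^ (q - p) * ‖u x‖ₑ ^ p := ENNReal.tsum_le_tsum fun x => by
        rw [← sub_add_cancel q p, ENNReal.rpow_add_of_nonneg _ _ (sub_nonneg.2 hpq) hp.le,
          sub_add_cancel]
        gcongr
        exact enorm_le_eLpNorm_count u x (by simpa using hp)
    _ = N ^ q := by
        rw [ENNReal.tsum_mul_left, ← eLpNorm_count_rpow hp,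
          ← ENNReal.rpow_add_of_nonneg _ _ (sub_nonneg.2 hpq) hp.le, sub_add_cancel]

theorem eLpNorm_count_convolution_le [AddCommGroup G] (hp : 1 ≤ p) (κ u : G → ℂ) :
    eLpNorm (fun x => ∑' y, κ (x - y) * u y) (ENNReal.ofReal p) Measure.count ≤
      (∑' x, ‖κ x‖ₑ) * eLpNorm u (ENNReal.ofReal p) Measure.count := by
  have hp0 : 0 < p := zero_lt_one.trans_le hp
  rw [← ENNReal.rpow_le_rpow_iff hp0, ENNReal.mul_rpow_of_nonneg _ _ hp0.le,
    eLpNorm_count_rpow hp0, eLpNorm_count_rpow hp0]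
  refine le_trans (ENNReal.tsum_le_tsum fun x => ?_)
    (ENNReal.tsum_convolution_rpow_le hp (fun x => ‖κ x‖ₑ) fun x => ‖u x‖ₑ)
  refine ENNReal.rpow_le_rpow (enorm_tsum_le_tsum_enorm.trans_eq ?_) hp0.le
  simp only [enorm_mul]

theorem ofReal_finLp_le_eLpNorm_count (hp : 0 < p) (F : Finset G) (u : G → ℂ) :
    ENNReal.ofReal (finLp p F u) ≤ eLpNorm u (ENNReal.ofReal p) Measure.count := by
  rw [ofReal_finLp hp, eLpNorm_count_eq_tsum hp]
  gcongr
  exact ENNReal.sum_le_tsum F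

theorem eLpNorm_count_eq_ofReal_finLp (hp : 0 < p) {F : Finset G} {u : G → ℂ}
    (hF : ∀ x ∉ F, u x = 0) :
    eLpNorm u (ENNReal.ofReal p) Measure.count = ENNReal.ofReal (finLp p F u) := by
  rw [ofReal_finLp hp, eLpNorm_count_eq_tsum hp, tsum_eq_sum fun x hx => by
    rw [hF x hx, enorm_zero, ENNReal.zero_rpow_of_pos hp]]

theorem eLpNorm_count_ne_top (hp : 0 < p) {u : G → ℂ} (hu : Memℓp u (ENNReal.ofReal p)) :
    eLpNorm u (ENNReal.ofReal p) Measure.count ≠ ∞ := by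
  have hpr : (ENNReal.ofReal p).toReal = p := ENNReal.toReal_ofReal hp.le
  have h := (memℓp_gen_iff (hpr.symm ▸ hp)).1 hu
  rw [hpr] at h
  rw [eLpNorm_count_eq_tsum hp]
  refine ENNReal.rpow_ne_top_of_nonneg (by positivity) ?_
  convert! h.tsum_ofReal_ne_top using 3 with x
  rw [← ENNReal.ofReal_rpow_of_nonneg (norm_nonneg _) hp.le, ofReal_norm]

theorem tendsto_eLpNorm_count_sub_indicator (hp : 0 < p) {u : G → ℂ}
    (hu : eLpNorm u (ENNReal.ofReal p) Measure.count ≠ ∞) :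
    Filter.Tendsto (fun F : Finset G => eLpNorm (fun x => u x - (F : Set G).indicator u x)
      (ENNReal.ofReal p) Measure.count) Filter.atTop (nhds 0) := by
  have hs : ∑' x, ‖u x‖ₑ ^ p ≠ ∞ := by
    rw [← eLpNorm_count_rpow hp]
    exact ENNReal.rpow_ne_top_of_nonneg hp.le hu
  have h := (ENNReal.tendsto_tsum_compl_atTop_zero hs).ennrpow_const (1 / p)
  rw [ENNReal.zero_rpow_of_pos (by positivity)] at h
  refine h.congr fun F => ?_
  rw [eLpNorm_count_eq_tsum hp]
  congr 1
  refine (tsum_subtype ((F : Set G)ᶜ) fun x => ‖u x‖ₑ ^ p).trans (tsum_congr fun x => ?_)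
  by_cases hx : x ∈ F <;> simp [hx, hp]

theorem tendsto_sum_rpow_eLpNorm_count (hq : 0 < q) (u : G → ℂ) :
    Filter.Tendsto (fun F : Finset G => (∑ x ∈ F, ‖u x‖ₑ ^ q) ^ (1 / q)) Filter.atTop
      (nhds (eLpNorm u (ENNReal.ofReal q) Measure.count)) := by
  rw [eLpNorm_count_eq_tsum hq]
  have h : HasSum (fun x => ‖u x‖ₑ ^ q) (∑' x, ‖u x‖ₑ ^ q) := ENNReal.summable.hasSum
  rw [HasSum, SummationFilter.unconditional_filter] at h
  exact h.ennrpow_const (1 / q)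

end countingNorm

section resolvent

/-- The `ℓ^1` norm of the kernel of `√(1 - Δ)`. -/
def sqrtKernelMass : ℝ := ∑' x : Fin 4 → ℤ, ‖multKernel 4 (omegaKG 4) x‖

theorem sqrtKernelMass_nonneg : 0 ≤ sqrtKernelMass := tsum_nonneg fun _ => norm_nonneg _

theorem tsum_enorm_multKernel_omegaKG :
    ∑' x : Fin 4 → ℤ, ‖multKernel 4 (omegaKG 4) x‖ₑ = ENNReal.ofReal sqrtKernelMass := by
  rw [sqrtKernelMass, ENNReal.ofReal_tsum_of_nonneg (fun _ => norm_nonneg _)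
    summable_norm_multKernel_omegaKG]
  simp only [ofReal_norm]

variable {p : ℝ}

theorem eLpNorm_sqrtOneSubLap_le (hp : 1 ≤ p) (u : (Fin 4 → ℤ) → ℂ) :
    eLpNorm (sqrtOneSubLap 4 u) (ENNReal.ofReal p) Measure.count ≤
      ENNReal.ofReal sqrtKernelMass * eLpNorm u (ENNReal.ofReal p) Measure.count := by
  rw [← tsum_enorm_multKernel_omegaKG]
  exact eLpNorm_count_convolution_le hp (multKernel 4 (omegaKG 4)) u

theorem summable_multKernel_omegaKG_mul (hp : 1 ≤ p) {u : (Fin 4 → ℤ) → ℂ}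
    (hu : eLpNorm u (ENNReal.ofReal p) Measure.count ≠ ∞) (x : Fin 4 → ℤ) :
    Summable fun y => multKernel 4 (omegaKG 4) (x - y) * u y := by
  have hx : Summable fun y => ‖multKernel 4 (omegaKG 4) (x - y)‖ :=
    (Equiv.subLeft x).summable_iff.2 summable_norm_multKernel_omegaKG
  refine .of_norm_bounded (hx.mul_right (eLpNorm u (ENNReal.ofReal p) Measure.count).toReal)
    fun y => ?_
  rw [norm_mul]
  gcongr
  rw [← toReal_enorm]
  exact ENNReal.toReal_mono hu (enorm_le_eLpNorm_count u y (by simp; linarith))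

theorem sqrtOneSubLap_sub (hp : 1 ≤ p) {u v : (Fin 4 → ℤ) → ℂ}
    (hu : eLpNorm u (ENNReal.ofReal p) Measure.count ≠ ∞)
    (hv : eLpNorm v (ENNReal.ofReal p) Measure.count ≠ ∞) (x : Fin 4 → ℤ) :
    sqrtOneSubLap 4 (fun y => u y - v y) x = sqrtOneSubLap 4 u x - sqrtOneSubLap 4 v x := by
  simp only [sqrtOneSubLap, mul_sub]
  exact (summable_multKernel_omegaKG_mul hp hu x).tsum_sub
    (summable_multKernel_omegaKG_mul hp hv x)

theorem sqrtOneSubLap_const_mul (c : ℂ) (u : (Fin 4 → ℤ) → ℂ) (x : Fin 4 → ℤ) :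
    sqrtOneSubLap 4 (fun y => c * u y) x = c * sqrtOneSubLap 4 u x := by
  simp only [sqrtOneSubLap, mul_left_comm _ c]
  exact tsum_mul_left

theorem eLpNorm_count_const_mul (c : ℂ) (u : (Fin 4 → ℤ) → ℂ) (q : ℝ≥0∞) :
    eLpNorm (fun x => c * u x) q Measure.count = ‖c‖ₑ * eLpNorm u q Measure.count :=
  eLpNorm_const_smul c u q Measure.count

theorem eLpNorm_count_sub_le (hp : 1 ≤ p) (u v : (Fin 4 → ℤ) → ℂ) :
    eLpNorm (fun x => u x - v x) (ENNReal.ofReal p) Measure.count ≤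
      eLpNorm u (ENNReal.ofReal p) Measure.count + eLpNorm v (ENNReal.ofReal p) Measure.count :=
  eLpNorm_sub_le .of_discrete .of_discrete (by simpa using hp)

theorem eLpNorm_sqrtOneSubLap_sub_mul_le (hp : 1 ≤ p) (lam : ℂ) (u : (Fin 4 → ℤ) → ℂ) :
    eLpNorm (fun x => sqrtOneSubLap 4 u x - lam * u x) (ENNReal.ofReal p) Measure.count ≤
      ENNReal.ofReal (sqrtKernelMass + ‖lam‖) *
        eLpNorm u (ENNReal.ofReal p) Measure.count := by
  refine (eLpNorm_count_sub_le hp (sqrtOneSubLap 4 u) fun x => lam * u x).trans ?_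
  rw [eLpNorm_count_const_mul, ENNReal.ofReal_add sqrtKernelMass_nonneg (norm_nonneg _),
    ofReal_norm, add_mul]
  gcongr
  exact eLpNorm_sqrtOneSubLap_le hp u

theorem eLpNorm_sqrtOneSubLap_add_mul_le (hp : 1 ≤ p) (lam : ℂ) (u : (Fin 4 → ℤ) → ℂ) :
    eLpNorm (fun x => sqrtOneSubLap 4 u x + lam * u x) (ENNReal.ofReal p) Measure.count ≤
      ENNReal.ofReal (sqrtKernelMass + ‖lam‖) *
        eLpNorm u (ENNReal.ofReal p) Measure.count := by
  simpa using eLpNorm_sqrtOneSubLap_sub_mul_le hp (-lam) u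

theorem eLpNorm_count_ne_top_of_finite_support (hp : 0 < p) {ψ : (Fin 4 → ℤ) → ℂ}
    (hψ : ψ.support.Finite) : eLpNorm ψ (ENNReal.ofReal p) Measure.count ≠ ∞ := by
  rw [eLpNorm_count_eq_ofReal_finLp hp (F := hψ.toFinset) fun x hx => by simpa using hx]
  exact ENNReal.ofReal_ne_top

theorem eLpNorm_le_of_large_norm (hp : 1 ≤ p) {lam : ℂ} (hlam : sqrtKernelMass + 1 ≤ ‖lam‖)
    {ψ : (Fin 4 → ℤ) → ℂ} (hψ : eLpNorm ψ (ENNReal.ofReal p) Measure.count ≠ ∞) :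
    eLpNorm ψ (ENNReal.ofReal p) Measure.count ≤
      eLpNorm (fun x => sqrtOneSubLap 4 ψ x - lam * ψ x) (ENNReal.ofReal p) Measure.count := by
  set N := eLpNorm ψ (ENNReal.ofReal p) Measure.count
  set f : (Fin 4 → ℤ) → ℂ := fun x => sqrtOneSubLap 4 ψ x - lam * ψ x with hf
  have h : ENNReal.ofReal sqrtKernelMass * N + N ≤ ENNReal.ofReal sqrtKernelMass * N +
      eLpNorm f (ENNReal.ofReal p) Measure.count := by
    calc ENNReal.ofReal sqrtKernelMass * N + N
        = ENNReal.ofReal (sqrtKernelMass + 1) * N := by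
          rw [ENNReal.ofReal_add sqrtKernelMass_nonneg zero_le_one, ENNReal.ofReal_one, add_mul,
            one_mul]
      _ ≤ ‖lam‖ₑ * N := by
          rw [← ofReal_norm]
          gcongr
      _ = eLpNorm (fun x => sqrtOneSubLap 4 ψ x - f x) (ENNReal.ofReal p) Measure.count := by
          rw [← eLpNorm_count_const_mul]
          simp only [hf, sub_sub_cancel]
      _ ≤ _ := (eLpNorm_count_sub_le hp (sqrtOneSubLap 4 ψ) f).trans <|
          add_le_add_left (eLpNorm_sqrtOneSubLap_le hp ψ) _
  exact (ENNReal.add_le_add_iff_left (ENNReal.mul_ne_top ENNReal.ofReal_ne_top hψ)).1 h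

/-- The factorisation `(√(1 - Δ) + λ)(√(1 - Δ) - λ) = 1 - Δ - λ²`. -/
theorem latticeAdj_sub_eq (hp : 1 ≤ p) (lam : ℂ) {ψ : (Fin 4 → ℤ) → ℂ} (hψ : ψ.support.Finite)
    (x : Fin 4 → ℤ) :
    latticeAdj ψ x - (9 - lam ^ 2) * ψ x =
      -(sqrtOneSubLap 4 (fun y => sqrtOneSubLap 4 ψ y - lam * ψ y) x +
        lam * (sqrtOneSubLap 4 ψ x - lam * ψ x)) := by
  have hfin := eLpNorm_count_ne_top_of_finite_support (zero_lt_one.trans_le hp) hψ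
  rw [sqrtOneSubLap_sub hp (u := sqrtOneSubLap 4 ψ) (v := fun y => lam * ψ y),
    sqrtOneSubLap_sqrtOneSubLap hψ, sqrtOneSubLap_const_mul]
  · ring
  · exact ne_top_of_le_ne_top (ENNReal.mul_ne_top ENNReal.ofReal_ne_top hfin)
      (eLpNorm_sqrtOneSubLap_le hp ψ)
  · rw [eLpNorm_count_const_mul]
    exact ENNReal.mul_ne_top enorm_ne_top hfin

theorem eLpNorm_six_le_of_small_norm (hp1 : 1 ≤ p) (hp : p < 6 / 5) {lam : ℂ}
    (hlam : ‖lam‖ ≤ sqrtKernelMass + 1) {ψ : (Fin 4 → ℤ) → ℂ} (hψ : ψ.support.Finite) :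
    eLpNorm ψ (ENNReal.ofReal 6) Measure.count ≤
      ENNReal.ofReal ((5 * 10 ^ 5 + 1) * interpConst p * (2 * sqrtKernelMass + 1)) *
        eLpNorm (fun x => sqrtOneSubLap 4 ψ x - lam * ψ x) (ENNReal.ofReal p)
          Measure.count := by
  have hp0 : 0 < p := zero_lt_one.trans_le hp1
  have hC : 0 < (5 * 10 ^ 5 + 1) * interpConst p := mul_pos (by norm_num) (interpConst_pos hp)
  set g : (Fin 4 → ℤ) → ℂ := fun x => latticeAdj ψ x - (9 - lam ^ 2) * ψ x with hg
  set S := (hψ.union (finite_support_latticeAdj hψ)).toFinset with hS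
  have hgS : ∀ x ∉ S, latticeAdj ψ x - (9 - lam ^ 2) * ψ x = 0 := fun x hx => by
    simp only [hS, Set.Finite.mem_toFinset, Set.mem_union, Function.mem_support, not_or,
      not_not] at hx
    rw [hx.1, hx.2, mul_zero, sub_zero]
  have hgN : eLpNorm g (ENNReal.ofReal p) Measure.count ≤
      ENNReal.ofReal (2 * sqrtKernelMass + 1) *
        eLpNorm (fun x => sqrtOneSubLap 4 ψ x - lam * ψ x) (ENNReal.ofReal p)
          Measure.count := by
    have hgn : g = -fun x => sqrtOneSubLap 4 (fun y => sqrtOneSubLap 4 ψ y - lam * ψ y) x +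
        lam * (sqrtOneSubLap 4 ψ x - lam * ψ x) := funext (latticeAdj_sub_eq hp1 lam hψ)
    rw [hgn, eLpNorm_neg]
    refine (eLpNorm_sqrtOneSubLap_add_mul_le hp1 lam _).trans ?_
    exact mul_le_mul' (ENNReal.ofReal_le_ofReal (by linarith)) le_rfl
  rw [eLpNorm_count_eq_ofReal_finLp (by norm_num) (F := hψ.toFinset) fun x hx => by simpa using hx]
  calc ENNReal.ofReal (finLp 6 hψ.toFinset ψ)
      ≤ ENNReal.ofReal ((5 * 10 ^ 5 + 1) * interpConst p * finLp p S g) :=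
        ENNReal.ofReal_le_ofReal (finLp_latticeAdj_sub_le _ hp0 hp hψ hgS _)
    _ ≤ _ := by
        rw [ENNReal.ofReal_mul hC.le, ENNReal.ofReal_mul hC.le, mul_assoc]
        gcongr
        exact (ofReal_finLp_le_eLpNorm_count hp0 S g).trans hgN

theorem eLpNorm_le_of_finite_support {q : ℝ} (hp1 : 1 ≤ p) (hp : p < 6 / 5) (hq : 6 ≤ q) (lam : ℂ)
    {ψ : (Fin 4 → ℤ) → ℂ} (hψ : ψ.support.Finite) :
    eLpNorm ψ (ENNReal.ofReal q) Measure.count ≤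
      ENNReal.ofReal ((5 * 10 ^ 5 + 1) * interpConst p * (2 * sqrtKernelMass + 1) + 1) *
        eLpNorm (fun x => sqrtOneSubLap 4 ψ x - lam * ψ x) (ENNReal.ofReal p)
          Measure.count := by
  have hp0 : 0 < p := zero_lt_one.trans_le hp1
  have hC : 0 ≤ (5 * 10 ^ 5 + 1) * interpConst p * (2 * sqrtKernelMass + 1) := by
    have := interpConst_pos hp
    have := sqrtKernelMass_nonneg
    positivity
  rcases le_total (sqrtKernelMass + 1) ‖lam‖ with h | h
  · refine (eLpNorm_count_anti hp0 (by linarith) ψ).trans <| (eLpNorm_le_of_large_norm hp1 h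
      (eLpNorm_count_ne_top_of_finite_support hp0 hψ)).trans (le_mul_of_one_le_left' ?_)
    rw [ENNReal.one_le_ofReal]
    linarith
  · refine (eLpNorm_count_anti (by norm_num) hq ψ).trans <|
      (eLpNorm_six_le_of_small_norm hp1 hp h hψ).trans ?_
    gcongr
    linarith

theorem eLpNorm_sqrtOneSubLap_sub_mul_perturb_le (hp : 1 ≤ p) (lam : ℂ)
    {ψ r : (Fin 4 → ℤ) → ℂ} (hψ : eLpNorm ψ (ENNReal.ofReal p) Measure.count ≠ ∞)
    (hr : eLpNorm r (ENNReal.ofReal p) Measure.count ≠ ∞) :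
    eLpNorm (fun x => sqrtOneSubLap 4 (fun y => ψ y - r y) x - lam * (ψ x - r x))
        (ENNReal.ofReal p) Measure.count ≤
      eLpNorm (fun x => sqrtOneSubLap 4 ψ x - lam * ψ x) (ENNReal.ofReal p) Measure.count +
        ENNReal.ofReal (sqrtKernelMass + ‖lam‖) * eLpNorm r (ENNReal.ofReal p) Measure.count := by
  have h : (fun x => sqrtOneSubLap 4 (fun y => ψ y - r y) x - lam * (ψ x - r x)) =
      fun x => (sqrtOneSubLap 4 ψ x - lam * ψ x) - (sqrtOneSubLap 4 r x - lam * r x) := by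
    ext x
    rw [sqrtOneSubLap_sub hp hψ hr]
    ring
  rw [h]
  exact (eLpNorm_count_sub_le hp _ _).trans
    (add_le_add_right (eLpNorm_sqrtOneSubLap_sub_mul_le hp lam r) _)

/-- Resolvent bounds on finitely supported functions extend to `ℓ^p`. -/
theorem eLpNorm_le_of_forall_finite_support {q C : ℝ} (hp : 1 ≤ p) (hq : 0 < q) {lam : ℂ}
    (h : ∀ ψ : (Fin 4 → ℤ) → ℂ, ψ.support.Finite →
      eLpNorm ψ (ENNReal.ofReal q) Measure.count ≤ ENNReal.ofReal C *
        eLpNorm (fun x => sqrtOneSubLap 4 ψ x - lam * ψ x) (ENNReal.ofReal p) Measure.count)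
    {ψ : (Fin 4 → ℤ) → ℂ} (hψ : eLpNorm ψ (ENNReal.ofReal p) Measure.count ≠ ∞) :
    eLpNorm ψ (ENNReal.ofReal q) Measure.count ≤ ENNReal.ofReal C *
        eLpNorm (fun x => sqrtOneSubLap 4 ψ x - lam * ψ x) (ENNReal.ofReal p) Measure.count := by
  have hp0 : 0 < p := zero_lt_one.trans_le hp
  have hF : ∀ F : Finset (Fin 4 → ℤ), (∑ x ∈ F, ‖ψ x‖ₑ ^ q) ^ (1 / q) ≤ ENNReal.ofReal C *
      (eLpNorm (fun x => sqrtOneSubLap 4 ψ x - lam * ψ x) (ENNReal.ofReal p) Measure.count +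
        ENNReal.ofReal (sqrtKernelMass + ‖lam‖) * eLpNorm
          (fun x => ψ x - (F : Set (Fin 4 → ℤ)).indicator ψ x) (ENNReal.ofReal p)
          Measure.count) := by
    intro F
    have hfin : ((F : Set (Fin 4 → ℤ)).indicator ψ).support.Finite :=
      F.finite_toSet.subset Set.support_indicator_subset
    have hr := ne_top_of_le_ne_top (ENNReal.add_ne_top.2
      ⟨hψ, eLpNorm_count_ne_top_of_finite_support hp0 hfin⟩)
      (eLpNorm_count_sub_le hp ψ ((F : Set (Fin 4 → ℤ)).indicator ψ))
    have hpert := eLpNorm_sqrtOneSubLap_sub_mul_perturb_le hp lam hψ hr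
    simp only [sub_sub_cancel] at hpert
    have hsum : (∑ x ∈ F, ‖ψ x‖ₑ ^ q) ^ (1 / q) =
        ENNReal.ofReal (finLp q F ((F : Set (Fin 4 → ℤ)).indicator ψ)) := by
      rw [ofReal_finLp hq]
      congr 1
      refine Finset.sum_congr rfl fun x hx => ?_
      rw [Set.indicator_of_mem (Finset.mem_coe.2 hx)]
    rw [hsum]
    exact (ofReal_finLp_le_eLpNorm_count hq F _).trans <| (h _ hfin).trans <|
      mul_le_mul' le_rfl hpert
  have hlim := ENNReal.Tendsto.const_mul (a := ENNReal.ofReal (sqrtKernelMass + ‖lam‖))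
    (tendsto_eLpNorm_count_sub_indicator hp0 hψ) (Or.inr ENNReal.ofReal_ne_top)
  have hlim' := ENNReal.Tendsto.const_mul (a := ENNReal.ofReal C) (hlim.const_add
    (eLpNorm (fun x => sqrtOneSubLap 4 ψ x - lam * ψ x) (ENNReal.ofReal p) Measure.count))
    (Or.inr ENNReal.ofReal_ne_top)
  rw [mul_zero, add_zero] at hlim'
  exact le_of_tendsto_of_tendsto' (tendsto_sum_rpow_eLpNorm_count hq ψ) hlim' hF

end resolvent

/-- Uniform resolvent estimate for `√(1−Δ)` on `ℤ⁴`: for every `σ ∈ (1, 3/2)`,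
`‖ψ‖_{ℓ^{2σ/(σ−1)}} ≤ C(σ) ‖(√(1−Δ) − λ)ψ‖_{ℓ^{2σ/(σ+1)}}` uniformly in `λ ∈ ℂ`. -/
theorem resolvent_estimate_d4 (σ : ℝ) (hσ₁ : 1 < σ) (hσ₂ : σ < 3/2) :
    ∃ C > (0:ℝ), ∀ (lam : ℂ) (ψ : (Fin 4 → ℤ) → ℂ),
      Memℓp ψ (ENNReal.ofReal (2 * σ / (σ + 1))) →
      eLpNorm ψ (ENNReal.ofReal (2 * σ / (σ - 1))) Measure.count ≤
        ENNReal.ofReal C *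
          eLpNorm (fun x => sqrtOneSubLap 4 ψ x - lam * ψ x)
            (ENNReal.ofReal (2 * σ / (σ + 1))) Measure.count := by
  have hp1 : 1 ≤ 2 * σ / (σ + 1) := by
    rw [le_div_iff₀ (by linarith)]
    linarith
  have hp : 2 * σ / (σ + 1) < 6 / 5 := by
    rw [div_lt_div_iff₀ (by linarith) (by norm_num)]
    linarith
  have hq : 6 ≤ 2 * σ / (σ - 1) := by
    rw [le_div_iff₀ (by linarith)]
    linarith
  refine ⟨(5 * 10 ^ 5 + 1) * interpConst (2 * σ / (σ + 1)) * (2 * sqrtKernelMass + 1) + 1, ?_,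
    fun lam ψ hψ => eLpNorm_le_of_forall_finite_support hp1 (by linarith)
      (fun φ hφ => eLpNorm_le_of_finite_support hp1 hp hq lam hφ)
      (eLpNorm_count_ne_top (by linarith) hψ)⟩
  have := interpConst_pos hp
  have := sqrtKernelMass_nonneg
  positivity
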